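/- arXiv:0704.2817 — 2 statements merged into one kernel-verified Lean document; each statement's English description precedes it below -/
import Mathlib

section
/- If m ∈ M_θ satisfies ε_k(m) = 0 for every odd integer k, then m = ∅ (the empty multisegment). In particular, for every m ∈ M_θ there exist ℓ ≥ 0 and odd integers i_1, …, i_ℓ such that m = F̃_{i_1} ⋯ F̃_{i_ℓ}(∅). -/
/-! Combinatorics of θ-restricted multisegments and their crystal operators
(Enomoto–Kashiwara, §4.1). -/

noncomputable section
open scoped Classical

/-- Multisegments as elements of the free abelian group on the segments `⟨i,j⟩`. -/
abbrev MS : Type := (ℤ × ℤ) →₀ ℤ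

/-- The segment `⟨i,j⟩` viewed as a multisegment. -/
def sg (i j : ℤ) : MS := Finsupp.single (i, j) 1

/-- `m` is a θ-restricted multisegment (`m_{i,j} = 0` unless `−j ≤ i ≤ j`, indices odd,
multiplicities nonnegative). -/
def IsTheta (m : MS) : Prop :=
  ∀ i j : ℤ, m (i, j) ≠ 0 → Odd i ∧ Odd j ∧ -j ≤ i ∧ i ≤ j ∧ 0 < m (i, j)

/-- `A_j^{(−k)}(m)` for a positive odd integer `k`. -/
def Aneg (k : ℤ) (m : MS) (j : ℤ) : ℤ :=
  if k < j then ∑ᶠ l : ℤ, if Odd l ∧ j ≤ l then m (-k, l) - m (-k + 2, l + 2) else 0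
  else if j = k then
    (∑ᶠ l : ℤ, if Odd l ∧ k < l then m (-k, l) - m (-k + 2, l) else 0)
      + 2 * m (-k, k) + (if Odd (m (-k + 2, k)) then 1 else 0)
  else
    (∑ᶠ l : ℤ, if Odd l ∧ k < l then m (-k, l) - m (-k + 2, l) else 0)
      + 2 * m (-k, k) - 2 * m (-k + 2, k - 2)
      + (∑ᶠ i : ℤ, if Odd i ∧ -k + 2 < i ∧ i ≤ j + 2 then m (i, k) else 0)
      - (∑ᶠ i : ℤ, if Odd i ∧ -k + 2 < i ∧ i ≤ j then m (i, k - 2) else 0)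

/-- `ε_{−k}(m) = max{A_j^{(−k)}(m) : j ≥ −k+2}`. -/
def epsNeg (k : ℤ) (m : MS) : ℤ :=
  sSup ((fun j => Aneg k m j) '' {j : ℤ | Odd j ∧ -k + 2 ≤ j})

/-- The rank function realizing the ordering `⋯ > k+2 > k > −k+2 > −k+4 > ⋯ > k−2`
on indices: `j` is larger in this ordering iff `rho k j` is larger in `ℤ`. -/
def rho (k j : ℤ) : ℤ := if k ≤ j then j else -j

/-- The index `n_f`: the smallest index (in the ordering above) attaining `ε_{−k}(m)`. -/
def nfIdx (k : ℤ) (m : MS) : ℤ :=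
  let r := sInf (rho k '' {j : ℤ | Odd j ∧ -k + 2 ≤ j ∧ Aneg k m j = epsNeg k m})
  if k ≤ r then r else -r

/-- The index `n_e`: the largest index (in the ordering above) attaining `ε_{−k}(m)`. -/
def neIdx (k : ℤ) (m : MS) : ℤ :=
  let r := sSup (rho k '' {j : ℤ | Odd j ∧ -k + 2 ≤ j ∧ Aneg k m j = epsNeg k m})
  if k ≤ r then r else -r

/-- The crystal operator `F̃_{−k}` of Definition 4.1. -/
def FtilNeg (k : ℤ) (m : MS) : MS :=
  if k < nfIdx k m then m - sg (-k + 2) (nfIdx k m) + sg (-k) (nfIdx k m)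
  else if nfIdx k m = k then
    (if Odd (m (-k + 2, k)) then m - sg (-k + 2) k + sg (-k) k
     else m - (if k ≠ 1 then sg (-k + 2) (k - 2) else 0) + sg (-k + 2) k)
  else m - (if nfIdx k m ≠ k - 2 then sg (nfIdx k m + 2) (k - 2) else 0) + sg (nfIdx k m + 2) k

/-- The crystal operator `Ẽ_{−k}` of Definition 4.1 (`none` stands for `0`). -/
def EtilNeg (k : ℤ) (m : MS) : Option MS :=
  if epsNeg k m = 0 then none
  else some (if k < neIdx k m then m - sg (-k) (neIdx k m) + sg (-k + 2) (neIdx k m)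
    else if neIdx k m = k then
      (if Odd (m (-k + 2, k)) then
        m - sg (-k + 2) k + (if k ≠ 1 then sg (-k + 2) (k - 2) else 0)
       else m - sg (-k) k + sg (-k + 2) k)
    else m - sg (neIdx k m + 2) k + (if neIdx k m ≠ k - 2 then sg (neIdx k m + 2) (k - 2) else 0))

/-- `n`-th iterate of `Ẽ_{−k}` (with `0 ↦ 0`). -/
def EtilNegIter (k : ℤ) (n : ℕ) (m : MS) : Option MS :=
  (fun o => Option.bind o (EtilNeg k))^[n] (some m)

/-- `A_j^{(k)}(m)` for a positive odd integer `k` and `j ≥ k` (Definition 3.7). -/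
def Apos (k : ℤ) (m : MS) (j : ℤ) : ℤ :=
  ∑ᶠ l : ℤ, if Odd l ∧ j ≤ l then m (k, l) - m (k + 2, l + 2) else 0

/-- `ε_k(m) = max{A_j^{(k)}(m) : j ≥ k}` for `k > 0`. -/
def epsPos (k : ℤ) (m : MS) : ℤ :=
  sSup ((fun j => Apos k m j) '' {j : ℤ | Odd j ∧ k ≤ j})

/-- The smallest `j ≥ k` attaining `ε_k(m)`. -/
def jfIdx (k : ℤ) (m : MS) : ℤ := sInf {j : ℤ | Odd j ∧ k ≤ j ∧ Apos k m j = epsPos k m}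

/-- The largest `j ≥ k` attaining `ε_k(m)`. -/
def jeIdx (k : ℤ) (m : MS) : ℤ := sSup {j : ℤ | Odd j ∧ k ≤ j ∧ Apos k m j = epsPos k m}

/-- The crystal operator `F̃_k` for `k > 0`. -/
def FtilPos (k : ℤ) (m : MS) : MS :=
  m - (if jfIdx k m ≠ k then sg (k + 2) (jfIdx k m) else 0) + sg k (jfIdx k m)

/-- The crystal operator `Ẽ_k` for `k > 0` (`none` stands for `0`). -/
def EtilPos (k : ℤ) (m : MS) : Option MS :=
  if epsPos k m = 0 then none
  else some (m - sg k (jeIdx k m) + (if jeIdx k m ≠ k then sg (k + 2) (jeIdx k m) else 0))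

/-- `ε_k(m)` for any odd `k`. -/
def eps (k : ℤ) (m : MS) : ℤ := if 0 < k then epsPos k m else epsNeg (-k) m

/-- The crystal operator `F̃_k` for any odd `k`. -/
def Ftil (k : ℤ) (m : MS) : MS := if 0 < k then FtilPos k m else FtilNeg (-k) m

/-- The crystal operator `Ẽ_k` for any odd `k`. -/
def Etil (k : ℤ) (m : MS) : Option MS := if 0 < k then EtilPos k m else EtilNeg (-k) m

/-- `n`-th iterate of `Ẽ_k` (with `0 ↦ 0`). -/
def EtilIter (k : ℤ) (n : ℕ) (m : MS) : Option MS :=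
  (fun o => Option.bind o (Etil k))^[n] (some m)


/-- `Σ_{ℓ ≥ j} m_{i,ℓ}` over odd `ℓ`. -/
def rowTail (m : MS) (i j : ℤ) : ℤ := ∑ᶠ l : ℤ, if Odd l ∧ j ≤ l then m (i, l) else 0

/-- The total length of `m`, up to a factor `2`. -/
def totalLength : MS →ₗ[ℤ] ℤ := Finsupp.linearCombination ℤ fun p : ℤ × ℤ => p.2 - p.1 + 2

theorem totalLength_sg (i j : ℤ) : totalLength (sg i j) = j - i + 2 := by
  simp [totalLength, sg]

theorem sg_apply (i j a b : ℤ) : sg i j (a, b) = if i = a ∧ j = b then 1 else 0 := by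
  simp [sg, Finsupp.single_apply]

theorem IsTheta.nonneg {m : MS} (h : IsTheta m) (i j : ℤ) : 0 ≤ m (i, j) := by
  by_cases h0 : m (i, j) = 0
  · exact h0.ge
  · exact (h i j h0).2.2.2.2.le

theorem IsTheta.totalLength_nonneg {m : MS} (h : IsTheta m) : 0 ≤ totalLength m := by
  rw [totalLength, Finsupp.linearCombination_apply]
  refine Finset.sum_nonneg fun p hp => ?_
  obtain ⟨-, -, -, h1, h2⟩ := h p.1 p.2 (by simpa using hp)
  exact mul_nonneg h2.le (by linarith)

theorem IsTheta.add_sg {m : MS} (h : IsTheta m) {i n : ℤ} (hi : Odd i) (hn : Odd n)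
    (h1 : -n ≤ i) (h2 : i ≤ n) : IsTheta (m + sg i n) := by
  intro a b hab
  have h0 := h.nonneg a b
  rw [Finsupp.add_apply, sg_apply] at hab ⊢
  split_ifs at hab ⊢ with hs
  · obtain ⟨rfl, rfl⟩ := hs
    exact ⟨hi, hn, h1, h2, by omega⟩
  · simpa using h a b (by simpa using hab)

theorem IsTheta.sub_sg {m : MS} (h : IsTheta m) {i n : ℤ} (hm : m (i, n) ≠ 0) :
    IsTheta (m - sg i n) := by
  intro a b hab
  have h0 := h i n hm
  rw [Finsupp.sub_apply, sg_apply] at hab ⊢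
  split_ifs at hab ⊢ with hs
  · obtain ⟨rfl, rfl⟩ := hs
    exact ⟨h0.1, h0.2.1, h0.2.2.1, h0.2.2.2.1, by omega⟩
  · simpa using h a b (by simpa using hab)

theorem finite_support_rowTail (m : MS) (i j : ℤ) :
    (Function.support fun l : ℤ => if Odd l ∧ j ≤ l then m (i, l) else 0).Finite := by
  refine (m.support.image Prod.snd).finite_toSet.subset fun l hl => ?_
  simp only [Function.mem_support, ne_eq, ite_eq_right_iff, not_forall] at hl
  obtain ⟨-, hl⟩ := hl
  simp only [Finset.coe_image, Set.mem_image, Finset.mem_coe, Finsupp.mem_support_iff]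
  exact ⟨(i, l), hl, rfl⟩

theorem rowTail_add (m m' : MS) (i j : ℤ) :
    rowTail (m + m') i j = rowTail m i j + rowTail m' i j := by
  rw [rowTail, rowTail, rowTail,
    ← finsum_add_distrib (finite_support_rowTail _ _ _) (finite_support_rowTail _ _ _)]
  refine finsum_congr fun l => ?_
  split_ifs <;> simp

theorem rowTail_sg {n : ℤ} (hn : Odd n) (a i j : ℤ) :
    rowTail (sg a n) i j = if a = i ∧ j ≤ n then 1 else 0 := by
  rw [rowTail, finsum_eq_single _ n]
  · simp [sg_apply, hn, ← ite_and, and_comm]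
  · intro l hl
    simp [sg_apply, hl.symm]

theorem rowTail_eq_zero {m : MS} {i : ℤ} (h : ∀ l, m (i, l) = 0) (j : ℤ) :
    rowTail m i j = 0 := by
  simp [rowTail, h]

theorem finsum_shift_eq_rowTail (m : MS) (i j : ℤ) :
    (∑ᶠ l : ℤ, if Odd l ∧ j ≤ l then m (i, l + 2) else 0) = rowTail m i (j + 2) := by
  rw [rowTail]
  conv_rhs => rw [← finsum_comp_equiv (Equiv.addRight (2 : ℤ))]
  refine finsum_congr fun l => ?_
  simp

theorem finite_support_shift (m : MS) (i j : ℤ) :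
    (Function.support fun l : ℤ => if Odd l ∧ j ≤ l then m (i, l + 2) else 0).Finite := by
  have := (finite_support_rowTail m i (j + 2)).preimage
    ((add_left_injective (2 : ℤ)).injOn)
  refine this.subset fun l hl => ?_
  simpa [Int.odd_add] using hl

theorem finsum_sub_shift (m : MS) (i i' j : ℤ) :
    (∑ᶠ l : ℤ, if Odd l ∧ j ≤ l then m (i, l) - m (i', l + 2) else 0)
      = rowTail m i j - rowTail m i' (j + 2) := by
  rw [← finsum_shift_eq_rowTail, rowTail,
    ← finsum_sub_distrib (finite_support_rowTail _ _ _) (finite_support_shift _ _ _)]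
  refine finsum_congr fun l => ?_
  split_ifs <;> simp

theorem finsum_sub_rowTail (m : MS) (i i' : ℤ) {k : ℤ} (hk : Odd k) :
    (∑ᶠ l : ℤ, if Odd l ∧ k < l then m (i, l) - m (i', l) else 0)
      = rowTail m i (k + 2) - rowTail m i' (k + 2) := by
  rw [rowTail, rowTail,
    ← finsum_sub_distrib (finite_support_rowTail _ _ _) (finite_support_rowTail _ _ _)]
  refine finsum_congr fun l => ?_
  have : (Odd l ∧ k < l) ↔ (Odd l ∧ k + 2 ≤ l) := by grind
  simp only [this]
  split_ifs <;> simp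

theorem IsTheta.rowTail_anti {m : MS} (h : IsTheta m) (i : ℤ) {j j' : ℤ} (hj : j ≤ j') :
    rowTail m i j' ≤ rowTail m i j := by
  refine finsum_le_finsum' (finite_support_rowTail _ _ _)
    (finite_support_rowTail _ _ _) fun l => ?_
  have := h.nonneg i l
  dsimp only
  split_ifs <;> grind

theorem IsTheta.apply_le_rowTail {m : MS} (h : IsTheta m) (i : ℤ) {j n : ℤ} (hn : Odd n)
    (hj : j ≤ n) : m (i, n) ≤ rowTail m i j := by
  have := single_le_finsum n (finite_support_rowTail m i j) fun l => by
    have := h.nonneg i l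
    split_ifs <;> simp [this]
  simp only [hn, hj, and_self, if_true] at this
  exact this

theorem rowTail_eq_of_row_eq_zero {m : MS} {i n : ℤ} (h : ∀ l < n, m (i, l) = 0) {j : ℤ}
    (hj : j ≤ n) : rowTail m i j = rowTail m i n := by
  refine finsum_congr fun l => ?_
  rcases lt_or_ge l n with hl | hl
  · simp [h l hl]
  · simp [hl, hj.trans hl]

theorem Apos_eq (k : ℤ) (m : MS) (j : ℤ) :
    Apos k m j = rowTail m k j - rowTail m (k + 2) (j + 2) :=
  finsum_sub_shift m k (k + 2) j

theorem Aneg_of_lt {k j : ℤ} (m : MS) (h : k < j) :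
    Aneg k m j = rowTail m (-k) j - rowTail m (-k + 2) (j + 2) := by
  rw [Aneg, if_pos h, finsum_sub_shift]

theorem Aneg_self {k : ℤ} (hk : Odd k) (m : MS) :
    Aneg k m k = rowTail m (-k) (k + 2) - rowTail m (-k + 2) (k + 2) + 2 * m (-k, k)
      + if Odd (m (-k + 2, k)) then 1 else 0 := by
  rw [Aneg, if_neg (lt_irrefl k), if_pos rfl, finsum_sub_rowTail m _ _ hk]

theorem Aneg_of_gt {k j : ℤ} (hk : Odd k) {m : MS} (hm : ∀ i l, -k + 2 < i → m (i, l) = 0)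
    (h : j < k) :
    Aneg k m j = rowTail m (-k) (k + 2) - rowTail m (-k + 2) (k + 2) + 2 * m (-k, k)
      - 2 * m (-k + 2, k - 2) := by
  have hU : ∀ b c : ℤ,
      (∑ᶠ i : ℤ, if Odd i ∧ -k + 2 < i ∧ i ≤ b then m (i, c) else 0) = 0 := by
    intro b c
    refine finsum_eq_zero_of_forall_eq_zero fun i => ?_
    split_ifs with hi
    · exact hm i c hi.2.1
    · rfl
  rw [Aneg, if_neg h.not_gt, if_neg h.ne, finsum_sub_rowTail m _ _ hk, hU, hU]
  ring

theorem epsPos_eq {k n : ℤ} {m : MS} (hn : Odd n) (hkn : k ≤ n)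
    (h : ∀ j, Odd j → k ≤ j → Apos k m j ≤ Apos k m n) : epsPos k m = Apos k m n :=
  IsGreatest.csSup_eq ⟨⟨n, ⟨hn, hkn⟩, rfl⟩, by rintro _ ⟨j, ⟨h1, h2⟩, rfl⟩; exact h j h1 h2⟩

theorem epsNeg_eq {k n : ℤ} {m : MS} (hn : Odd n) (hkn : -k + 2 ≤ n)
    (h : ∀ j, Odd j → -k + 2 ≤ j → Aneg k m j ≤ Aneg k m n) : epsNeg k m = Aneg k m n :=
  IsGreatest.csSup_eq ⟨⟨n, ⟨hn, hkn⟩, rfl⟩, by rintro _ ⟨j, ⟨h1, h2⟩, rfl⟩; exact h j h1 h2⟩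

theorem jfIdx_eq {k n : ℤ} {m : MS} (hn : Odd n) (hkn : k ≤ n)
    (h : ∀ j, Odd j → k ≤ j → Apos k m j ≤ Apos k m n)
    (h' : ∀ j, Odd j → k ≤ j → j < n → Apos k m j < Apos k m n) : jfIdx k m = n := by
  have he := epsPos_eq hn hkn h
  refine IsLeast.csInf_eq ⟨⟨hn, hkn, he.symm⟩, ?_⟩
  rintro j ⟨h1, h2, h3⟩
  by_contra! hj
  exact absurd (h3.trans he) (h' j h1 h2 hj).ne

theorem nfIdx_eq {k n : ℤ} {m : MS} (hk : 0 < k) (hn : Odd n) (hkn : k ≤ n)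
    (h : ∀ j, Odd j → -k + 2 ≤ j → Aneg k m j ≤ Aneg k m n)
    (h' : ∀ j, Odd j → -k + 2 ≤ j → j < n → Aneg k m j < Aneg k m n) : nfIdx k m = n := by
  have he := epsNeg_eq hn (by grind) h
  have hr : sInf (rho k '' {j : ℤ | Odd j ∧ -k + 2 ≤ j ∧ Aneg k m j = epsNeg k m}) = n := by
    refine IsLeast.csInf_eq ⟨⟨n, ⟨hn, by grind, he.symm⟩, if_pos hkn⟩, ?_⟩
    rintro _ ⟨j, ⟨h1, h2, h3⟩, rfl⟩
    have hj : n ≤ j := by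
      by_contra! hj
      exact absurd (h3.trans he) (h' j h1 h2 hj).ne
    rwa [rho, if_pos (hkn.trans hj)]
  simp only [nfIdx, hr, if_pos hkn]

theorem FtilPos_add_sg {k n : ℤ} {q : MS} (hq : IsTheta q) (hn : Odd n) (hkn : k ≤ n)
    (hrow : ∀ i l, k < i → q (i, l) = 0) (hlow : ∀ l < n, q (k, l) = 0) :
    FtilPos k (q + if n ≠ k then sg (k + 2) n else 0) = q + sg k n := by
  set m := q + if n ≠ k then sg (k + 2) n else 0 with hm
  have hA : ∀ j, Odd j → k ≤ j →
      Apos k m j = rowTail q k j - if j < n then 1 else 0 := by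
    intro j hj hkj
    have h0 : rowTail q (k + 2) (j + 2) = 0 :=
      rowTail_eq_zero (fun l => hrow _ _ (by omega)) _
    rw [Apos_eq, hm]
    split_ifs with h1 h2 h2
    · simp [rowTail_add, rowTail_sg hn, h0]; grind
    · simp [rowTail_add, rowTail_sg hn, h0]; grind
    · omega
    · simp [h0]
  have hlt : ∀ j, Odd j → k ≤ j → j < n → Apos k m j < Apos k m n := by
    intro j hj hkj hjn
    rw [hA j hj hkj, hA n hn hkn, rowTail_eq_of_row_eq_zero hlow hjn.le]
    simp [hjn]
  have hle : ∀ j, Odd j → k ≤ j → Apos k m j ≤ Apos k m n := by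
    intro j hj hkj
    rcases lt_or_ge j n with hjn | hjn
    · exact (hlt j hj hkj hjn).le
    · rw [hA j hj hkj, hA n hn hkn]
      simpa [hjn.not_gt] using hq.rowTail_anti k hjn
  rw [FtilPos, jfIdx_eq hn hkn hle hlt, hm]
  abel

theorem FtilNeg_add_sg {k n : ℤ} {q : MS} (hq : IsTheta q) (hk : Odd k) (hk0 : 0 < k)
    (hn : Odd n) (hkn : k ≤ n) (hrow : ∀ i l, -k < i → q (i, l) = 0)
    (hlow : ∀ l < n, q (-k, l) = 0) :
    FtilNeg k (q + sg (-k + 2) n) = q + sg (-k) n := by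
  set m := q + sg (-k + 2) n with hm
  have hT : ∀ j, rowTail m (-k) j = rowTail q (-k) j := fun j => by
    simp [hm, rowTail_add, rowTail_sg hn]
  have hT' : ∀ j, rowTail m (-k + 2) j = if j ≤ n then 1 else 0 := fun j => by
    simp [hm, rowTail_add, rowTail_sg hn,
      rowTail_eq_zero fun l => hrow (-k + 2) l (by omega)]
  have hmk : m (-k, k) = q (-k, k) := by simp [hm, sg_apply]
  have hmk' : ∀ l, m (-k + 2, l) = if n = l then 1 else 0 := fun l => by
    simp [hm, sg_apply, hrow (-k + 2) l (by omega)]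
  have hA1 : ∀ j, k < j → Aneg k m j = rowTail q (-k) j - if j + 2 ≤ n then 1 else 0 :=
    fun j hj => by rw [Aneg_of_lt m hj, hT, hT']
  have hA2 : Aneg k m k = rowTail q (-k) (k + 2) - (if k + 2 ≤ n then 1 else 0)
      + 2 * q (-k, k) + if n = k then 1 else 0 := by
    rw [Aneg_self hk, hT, hT', hmk, hmk']
    by_cases h : n = k <;> simp [h]
  have hA3 : ∀ j, j < k → Aneg k m j = rowTail q (-k) (k + 2)
      - (if k + 2 ≤ n then 1 else 0) + 2 * q (-k, k) := fun j hj => by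
    rw [Aneg_of_gt hk _ hj, hT, hT', hmk, hmk', if_neg (by omega : ¬ n = k - 2)]
    · ring
    · intro i l hi
      simp [hm, sg_apply, hrow i l (by omega), hi.ne]
  have hlt : ∀ j, Odd j → -k + 2 ≤ j → j < n → Aneg k m j < Aneg k m n := by
    intro j hj hkj hjn
    rcases hkn.eq_or_lt with rfl | hkn
    · rw [hA3 j hjn, hA2]
      simp
    · have hkn2 : k + 2 ≤ n := by grind
      have hjn2 : j + 2 ≤ n := by grind
      have h1 := rowTail_eq_of_row_eq_zero hlow hkn2
      have h2 := rowTail_eq_of_row_eq_zero hlow hjn.le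
      have h3 := hlow k hkn
      rcases lt_trichotomy j k with h | rfl | h
      · rw [hA3 j h, hA1 n hkn]; simp [*]
      · rw [hA2, hA1 n hkn]; simp [*, hkn.ne']
      · rw [hA1 j h, hA1 n hkn]; simp [*]
  have hle : ∀ j, Odd j → -k + 2 ≤ j → Aneg k m j ≤ Aneg k m n := by
    intro j hj hkj
    rcases lt_trichotomy j n with hjn | rfl | hjn
    · exact (hlt j hj hkj hjn).le
    · exact le_rfl
    · have hjk : k < j := by omega
      have h0 := hq.nonneg (-k) k
      rw [hA1 j hjk, if_neg (by omega)]
      rcases hkn.eq_or_lt with rfl | hkn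
      · have := hq.rowTail_anti (-k) (show k + 2 ≤ j by grind)
        rw [hA2, if_neg (by omega), if_pos rfl]
        omega
      · have := hq.rowTail_anti (-k) hjn.le
        rw [hA1 n hkn, if_neg (by omega)]
        omega
  have hnf := nfIdx_eq hk0 hn hkn hle hlt
  rw [FtilNeg, hnf]
  rcases hkn.eq_or_lt with rfl | hkn
  · rw [if_neg (lt_irrefl k), if_pos rfl, if_pos (by rw [hmk']; simp), hm]
    abel
  · rw [if_pos hkn, hm]
    abel

theorem epsPos_pos {k n : ℤ} {m : MS} (hm : IsTheta m) (hk : Odd k) (hn : Odd n)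
    (hkn : k ≤ n) (hrow : ∀ i l, k < i → m (i, l) = 0) (hmn : m (k, n) ≠ 0) :
    0 < epsPos k m := by
  have hA : ∀ j, Apos k m j = rowTail m k j := fun j => by
    rw [Apos_eq, rowTail_eq_zero fun l => hrow (k + 2) l (by omega), sub_zero]
  rw [epsPos_eq hk le_rfl fun j _ hkj => by rw [hA, hA]; exact hm.rowTail_anti k hkj, hA]
  exact (hm k n hmn).2.2.2.2.trans_le (hm.apply_le_rowTail k hn hkn)

theorem epsNeg_pos {k n : ℤ} {m : MS} (hm : IsTheta m) (hk : Odd k) (hk0 : 0 < k)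
    (hn : Odd n) (hkn : k ≤ n) (hrow : ∀ i l, -k < i → m (i, l) = 0)
    (hmn : m (-k, n) ≠ 0) : 0 < epsNeg k m := by
  have hz : ∀ j, rowTail m (-k + 2) j = 0 :=
    rowTail_eq_zero fun l => hrow (-k + 2) l (by omega)
  have hA2 : Aneg k m k = rowTail m (-k) (k + 2) + 2 * m (-k, k) := by
    rw [Aneg_self hk, hz, hrow (-k + 2) k (by omega)]
    simp
  have h0 := hm.nonneg (-k) k
  rw [epsNeg_eq hk (by grind) fun j hj hkj => ?_, hA2]
  · have hpos := (hm (-k) n hmn).2.2.2.2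
    rcases hkn.eq_or_lt with rfl | hkn
    · have hT : 0 ≤ rowTail m (-k) (k + 2) :=
        (hm.nonneg (-k) (k + 2)).trans (hm.apply_le_rowTail (-k) (by grind) le_rfl)
      omega
    · have := hm.apply_le_rowTail (-k) hn (show k + 2 ≤ n by grind)
      omega
  · rcases lt_trichotomy j k with h | rfl | h
    · rw [hA2, Aneg_of_gt hk (fun i l hi => hrow i l (by omega)) h, hz,
        hrow (-k + 2) (k - 2) (by omega)]
      simp
    · exact le_rfl
    · have := hm.rowTail_anti (-k) (show k + 2 ≤ j by grind)
      rw [hA2, Aneg_of_lt m h, hz]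
      omega

/-- A nonzero multisegment has a segment with maximal left end and, among those, minimal
right end. -/
theorem exists_extremal_segment {m : MS} (h : m ≠ 0) :
    ∃ i n : ℤ, m (i, n) ≠ 0 ∧ (∀ a l, i < a → m (a, l) = 0) ∧ ∀ l < n, m (i, l) = 0 := by
  obtain ⟨p, hp, hmax⟩ := m.support.exists_max_image Prod.fst (Finsupp.support_nonempty_iff.2 h)
  obtain ⟨s, hs, hmin⟩ := (m.support.filter fun s => s.1 = p.1).exists_min_image Prod.snd
    ⟨p, by simpa using hp⟩
  simp only [Finset.mem_filter, Finsupp.mem_support_iff, and_imp] at hs hmin hmax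
  refine ⟨p.1, s.2, ?_, fun a l ha => ?_, fun l hl => ?_⟩
  · rw [← hs.2]
    exact hs.1
  · by_contra h0
    exact (hmax (a, l) h0).not_gt ha
  · by_contra h0
    exact (hmin (p.1, l) h0 rfl).not_gt hl

theorem exists_eps_ne_zero {m : MS} (hm : IsTheta m) (h : m ≠ 0) :
    ∃ k, Odd k ∧ eps k m ≠ 0 := by
  obtain ⟨i, n, hin, hrow, -⟩ := exists_extremal_segment h
  obtain ⟨hi, hn, h1, h2, -⟩ := hm i n hin
  refine ⟨i, hi, ?_⟩
  rw [eps]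
  split_ifs with hi0
  · exact (epsPos_pos hm hi hn h2 hrow hin).ne'
  · exact (epsNeg_pos hm hi.neg (by grind) hn (by omega) (by simpa using hrow)
      (by simpa using hin)).ne'

theorem exists_Ftil_eq {m : MS} (hm : IsTheta m) (h : m ≠ 0) :
    ∃ k m', Odd k ∧ IsTheta m' ∧ Ftil k m' = m ∧ totalLength m' < totalLength m := by
  obtain ⟨i, n, hin, hrow, hlow⟩ := exists_extremal_segment h
  obtain ⟨hi, hn, h1, h2, -⟩ := hm i n hin
  have hq := hm.sub_sg hin
  have hqrow : ∀ a l, i < a → (m - sg i n) (a, l) = 0 := fun a l ha => by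
    simp [sg_apply, hrow a l ha, ha.ne]
  have hqlow : ∀ l < n, (m - sg i n) (i, l) = 0 := fun l hl => by
    simp [sg_apply, hlow l hl, hl.ne']
  by_cases hi0 : 0 < i
  · refine ⟨i, m - sg i n + if n ≠ i then sg (i + 2) n else 0, hi, ?_, ?_, ?_⟩
    · split_ifs with hni
      · exact hq.add_sg (by grind) hn (by omega) (by grind)
      · simpa using hq
    · rw [Ftil, if_pos hi0, FtilPos_add_sg hq hn h2 hqrow hqlow, sub_add_cancel]
    · split_ifs <;> simp [totalLength_sg] <;> omega
  · refine ⟨i, m - sg i n + sg (i + 2) n, hi,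
      hq.add_sg (by grind) hn (by omega) (by grind), ?_, ?_⟩
    · have := FtilNeg_add_sg hq hi.neg (by grind) hn (by omega) (by simpa using hqrow)
        (by simpa using hqlow)
      rw [neg_neg, sub_add_cancel] at this
      rw [Ftil, if_neg hi0, this]
    · simp only [map_add, map_sub, totalLength_sg]
      omega

/-- Lemma 4.7 of Enomoto–Kashiwara: if `ε_k(m) = 0` for every odd `k`, then `m` is the
empty multisegment; consequently every θ-restricted multisegment is obtained from `∅`
by applying the operators `F̃_i`. -/
theorem highest_weight_vector_unique :
    (∀ m : MS, IsTheta m → (∀ k : ℤ, Odd k → eps k m = 0) → m = 0) ∧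
    (∀ m : MS, IsTheta m → ∃ l : List ℤ, (∀ i ∈ l, Odd i) ∧
      m = l.foldr (fun i acc => Ftil i acc) 0) := by
  refine ⟨fun m hm h => ?_, fun m hm => ?_⟩
  · by_contra h0
    obtain ⟨k, hk, hne⟩ := exists_eps_ne_zero hm h0
    exact hne (h k hk)
  · induction hL : (totalLength m).toNat using Nat.strong_induction_on generalizing m with
    | _ N ih =>
      by_cases h0 : m = 0
      · exact ⟨[], by simp, by simpa using h0⟩
      · obtain ⟨k, m', hk, hm', hF, hlt⟩ := exists_Ftil_eq hm h0
        have := hm'.totalLength_nonneg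
        obtain ⟨l, hl, hml⟩ := ih _ (by omega) m' hm' rfl
        exact ⟨k :: l, by simpa [hk] using hl, by rw [List.foldr_cons, ← hml, hF]⟩

end
end

section
/- Let C: B → M with C(b) ∈ M_{wt(b)} and M = Σ_{b∈B} K·C(b); let ξ be a map from B to a partially ordered set; let c, f̂, ê: Z → R be functions; let B = B' ∪ B'' be a decomposition; and let (E_{b,b'}) and (F_{b,b'}) be families of scalars in K with e·C(b) = Σ_{b'} E_{b,b'} C(b') and f·C(b) = Σ_{b'} F_{b,b'} C(b'). Assume, writing l = ε(b) and l' = ε(b') throughout: (4.4) c(0) = 0 and c(n) > 0 for n ≠ 0; (4.5) c(n) ≤ n + c(m+n) + ê(m) for all m ∈ Z and all n ≥ 0; (4.6) c(n) ≤ c(m+n) + f̂(m) for all m ∈ Z and all n ≤ 0; (4.7) c(n) + f̂(n) > 0 for n > 0; (4.8) c(n) + ê(n) > 0 for n > 0; (4.9) ord(F_{b,b'}) ≥ −l + f̂(l+1−l') for all b, b'; (4.10) ord(E_{b,b'}) ≥ 1 − l + ê(l−1−l') for all b, b'; (4.11) F_{b,f̃b} ∈ q^{−l}(1 + qA_0);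 (4.12) E_{b,ẽb} ∈ q^{1−l}(1 + qA_0) whenever l > 0; (4.13) ord(F_{b,b'}) > −l + f̂(l+1−l') whenever b' ≠ f̃b and ξ(b') < ξ(f̃b) does not hold; (4.14) ord(F_{b,b'}) > −l + f̂(l+1−l') whenever f̃b ∈ B', b' ≠ f̃b and l ≤ l'−1; (4.15) ord(E_{b,b'}) > 1 − l + ê(l−1−l') whenever b ∈ B'', b' ≠ ẽb and l ≤ l'+1. Then, setting L = Σ_{b∈B} A_0·C(b), one has ẽL ⊆ L and f̃L ⊆ L, and ẽC(b) ≡ C(ẽb) (mod qL) and f̃C(b) ≡ C(f̃b) (mod qL) for every b ∈ B, where C(0) = 0. -/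
noncomputable section
open scoped Classical

/-- The base field `K = ℚ(q)`. -/
abbrev K : Type := RatFunc ℚ

/-- The indeterminate `q`. -/
def q : K := RatFunc.X

/-- The `q`-integer `[n]`. -/
def qint (n : ℤ) : K := (q ^ n - q ^ (-n)) / (q - q⁻¹)

/-- The subring `A_0 ⊂ K` of rational functions regular at `q = 0`. -/
def Azero : Set K := {x : K | Polynomial.eval 0 x.denom ≠ 0}

/-- `ord(a) ≥ r`, where `ord(a) = sup{n ∈ ℤ : a ∈ qⁿA_0}` (`ord 0 = ∞`). -/
def ordGE (a : K) (r : ℝ) : Prop := ∃ n : ℤ, r ≤ (n : ℝ) ∧ q ^ (-n) * a ∈ Azero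

/-- `ord(a) > r`. -/
def ordGT (a : K) (r : ℝ) : Prop := ∃ n : ℤ, r < (n : ℝ) ∧ q ^ (-n) * a ∈ Azero

/-- `ord(a) = r`. -/
def ordEQ (a : K) (r : ℝ) : Prop := ordGE a r ∧ ¬ ordGT a r

/-- `a ∈ q^l(1 + qA_0)`. -/
def inUnitBall (a : K) (l : ℤ) : Prop := ∃ b ∈ Azero, a = q ^ l * (1 + q * b)

/-- The `q`-factorial `[n]!`. -/
def qfact (n : ℕ) : K := ∏ k ∈ Finset.range n, qint (k + 1)

/-- The defining relation `ef = q⁻²fe + 1` of the algebra `K[e,f]`; the generator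
`true` is `e` and `false` is `f`. -/
inductive EFRel : FreeAlgebra K Bool → FreeAlgebra K Bool → Prop
  | qboson : EFRel (FreeAlgebra.ι K true * FreeAlgebra.ι K false)
      ((q ^ (-2 : ℤ)) • (FreeAlgebra.ι K false * FreeAlgebra.ι K true) + 1)

/-- The algebra `K[e,f]`. -/
abbrev EF : Type := RingQuot EFRel

/-- The generator `e`. -/
def eg : EF := RingQuot.mkAlgHom K EFRel (FreeAlgebra.ι K true)

/-- The generator `f`. -/
def fg : EF := RingQuot.mkAlgHom K EFRel (FreeAlgebra.ι K false)

/-- The divided power `f^{(n)} = fⁿ/[n]!`. -/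
lemma azero_of_dvd {x : K} {p : Polynomial ℚ} (hp : Polynomial.eval 0 p ≠ 0)
    (h : x.denom ∣ p) : x ∈ Azero := by
  obtain ⟨r, rfl⟩ := h
  rw [Polynomial.eval_mul] at hp
  exact left_ne_zero_of_mul hp

lemma azero_algebraMap (p : Polynomial ℚ) : algebraMap (Polynomial ℚ) K p ∈ Azero := by
  simp [Azero]

/-- `A_0` as a subring of `K`. -/
def A0 : Subring K where
  carrier := Azero
  mul_mem' {x y} hx hy := azero_of_dvd (p := x.denom * y.denom)
    (by rw [Polynomial.eval_mul]; exact mul_ne_zero hx hy) (RatFunc.denom_mul_dvd x y)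
  add_mem' {x y} hx hy := azero_of_dvd (p := x.denom * y.denom)
    (by rw [Polynomial.eval_mul]; exact mul_ne_zero hx hy) (RatFunc.denom_add_dvd x y)
  one_mem' := by simpa using azero_algebraMap 1
  zero_mem' := by simpa using azero_algebraMap 0
  neg_mem' {x} hx := azero_of_dvd (x := -x) (p := x.denom) hx (by
    rw [RatFunc.denom_dvd (RatFunc.denom_ne_zero x)]
    exact ⟨-x.num, by rw [map_neg, neg_div, RatFunc.num_div_denom]⟩)

lemma mem_A0 {x : K} : x ∈ A0 ↔ x ∈ Azero := Iff.rfl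

lemma q_ne_zero : q ≠ 0 := RatFunc.X_ne_zero

lemma q_mem : q ∈ A0 := by
  have h := azero_algebraMap Polynomial.X
  rwa [RatFunc.algebraMap_X] at h

lemma q_zpow_mem {n : ℤ} (hn : 0 ≤ n) : q ^ n ∈ A0 := by
  lift n to ℕ using hn
  rw [zpow_natCast]
  exact pow_mem q_mem n

/-- Elements of `1 + qA_0` are units of `A_0`. -/
lemma one_add_inv_mem {b : K} (hb : b ∈ A0) : (1 + q * b) ≠ 0 ∧ (1 + q * b)⁻¹ ∈ A0 := by
  have hd : b.denom ≠ 0 := RatFunc.denom_ne_zero b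
  have key : (1 + q * b) =
      algebraMap (Polynomial ℚ) K (b.denom + Polynomial.X * b.num) /
        algebraMap (Polynomial ℚ) K b.denom := by
    have hd' : algebraMap (Polynomial ℚ) K b.denom ≠ 0 := by simpa using hd
    conv_lhs => rw [← RatFunc.num_div_denom b]
    rw [map_add, map_mul, RatFunc.algebraMap_X, q]
    field_simp
  have he : Polynomial.eval 0 (b.denom + Polynomial.X * b.num) ≠ 0 := by
    simpa [Azero] using mem_A0.1 hb
  have hn : b.denom + Polynomial.X * b.num ≠ 0 := fun h => he (by simp [h])
  constructor
  · rw [key]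
    exact div_ne_zero (RatFunc.algebraMap_ne_zero hn)
      (by simpa using hd)
  · rw [key, inv_div]
    exact azero_of_dvd he (RatFunc.denom_div_dvd _ _)

lemma q_sq_ne_one : q ^ 2 ≠ 1 := by
  intro h
  have h1 : algebraMap (Polynomial ℚ) K (Polynomial.X ^ 2) = algebraMap (Polynomial ℚ) K 1 := by
    simpa [q] using h
  have h2 := RatFunc.algebraMap_injective ℚ h1
  have h3 := congrArg (Polynomial.eval 0) h2
  simp at h3

lemma ordGE.of_le {a : K} {r s : ℝ} (h : ordGE a r) (hs : s ≤ r) : ordGE a s :=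
  let ⟨n, hn, ha⟩ := h; ⟨n, hs.trans hn, ha⟩

lemma ordGT.of_le {a : K} {r s : ℝ} (h : ordGT a r) (hs : s ≤ r) : ordGT a s :=
  let ⟨n, hn, ha⟩ := h; ⟨n, hs.trans_lt hn, ha⟩

lemma ordGE.ordGT_of_lt {a : K} {r s : ℝ} (h : ordGE a r) (hs : s < r) : ordGT a s :=
  let ⟨n, hn, ha⟩ := h; ⟨n, hs.trans_le hn, ha⟩

lemma ordGT.toOrdGE {a : K} {r : ℝ} (h : ordGT a r) : ordGE a r :=
  let ⟨n, hn, ha⟩ := h; ⟨n, hn.le, ha⟩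

lemma ordGE_zero (r : ℝ) : ordGE 0 r :=
  ⟨⌈r⌉, Int.le_ceil r, by rw [mul_zero]; exact A0.zero_mem⟩

lemma ordGT_zero (r : ℝ) : ordGT 0 r :=
  (ordGE_zero (r + 1)).ordGT_of_lt (by linarith)

lemma zpow_neg_mul_mem_of_le {a : K} {m n : ℤ} (h : q ^ (-n) * a ∈ A0) (hm : m ≤ n) :
    q ^ (-m) * a ∈ A0 := by
  have : q ^ (-m) * a = q ^ (n - m) * (q ^ (-n) * a) := by
    rw [← mul_assoc, ← zpow_add₀ q_ne_zero]; congr 2; ring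
  rw [this]
  exact A0.mul_mem (q_zpow_mem (by omega)) h

lemma ordGE.add {a b : K} {r : ℝ} (ha : ordGE a r) (hb : ordGE b r) : ordGE (a + b) r := by
  obtain ⟨n, hn, ha⟩ := ha
  obtain ⟨m, hm, hb⟩ := hb
  refine ⟨min n m, by simp [hn, hm], ?_⟩
  rw [mul_add]
  exact A0.add_mem (zpow_neg_mul_mem_of_le ha (min_le_left _ _))
    (zpow_neg_mul_mem_of_le hb (min_le_right _ _))

lemma ordGT.add {a b : K} {r : ℝ} (ha : ordGT a r) (hb : ordGT b r) : ordGT (a + b) r := by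
  obtain ⟨n, hn, ha⟩ := ha
  obtain ⟨m, hm, hb⟩ := hb
  refine ⟨min n m, by simp [hn, hm], ?_⟩
  rw [mul_add]
  exact A0.add_mem (zpow_neg_mul_mem_of_le ha (min_le_left _ _))
    (zpow_neg_mul_mem_of_le hb (min_le_right _ _))

lemma zpow_neg_add_mul_mem {a b : K} {m n : ℤ} (ha : q ^ (-n) * a ∈ A0)
    (hb : q ^ (-m) * b ∈ A0) : q ^ (-(n + m)) * (a * b) ∈ A0 := by
  have : q ^ (-(n + m)) * (a * b) = (q ^ (-n) * a) * (q ^ (-m) * b) := by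
    rw [neg_add, zpow_add₀ q_ne_zero]; ring
  rw [this]
  exact A0.mul_mem ha hb

lemma ordGE.mul {a b : K} {r s : ℝ} (ha : ordGE a r) (hb : ordGE b s) :
    ordGE (a * b) (r + s) := by
  obtain ⟨n, hn, ha⟩ := ha
  obtain ⟨m, hm, hb⟩ := hb
  exact ⟨n + m, by push_cast; linarith, zpow_neg_add_mul_mem ha hb⟩

lemma ordGT.mul_ordGE {a b : K} {r s : ℝ} (ha : ordGT a r) (hb : ordGE b s) :
    ordGT (a * b) (r + s) := by
  obtain ⟨n, hn, ha⟩ := ha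
  obtain ⟨m, hm, hb⟩ := hb
  exact ⟨n + m, by push_cast; linarith, zpow_neg_add_mul_mem ha hb⟩

lemma ordGE.mul_ordGT {a b : K} {r s : ℝ} (ha : ordGE a r) (hb : ordGT b s) :
    ordGT (a * b) (r + s) := by
  rw [mul_comm, add_comm]; exact hb.mul_ordGE ha

lemma ordGE.neg {a : K} {r : ℝ} (ha : ordGE a r) : ordGE (-a) r := by
  obtain ⟨n, hn, ha⟩ := ha
  exact ⟨n, hn, by rw [mul_neg]; exact A0.neg_mem ha⟩

lemma ordGT.neg {a : K} {r : ℝ} (ha : ordGT a r) : ordGT (-a) r := by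
  obtain ⟨n, hn, ha⟩ := ha
  exact ⟨n, hn, by rw [mul_neg]; exact A0.neg_mem ha⟩

lemma ordGE_of_mem {a : K} (ha : a ∈ A0) : ordGE a 0 := ⟨0, by simp, by simpa using mem_A0.1 ha⟩

lemma ordGE_zpow (n : ℤ) : ordGE (q ^ n) n :=
  ⟨n, le_rfl, by
    rw [← zpow_add₀ q_ne_zero, neg_add_cancel, zpow_zero]; exact A0.one_mem⟩

lemma ordGT.exists_eq_q_mul {a : K} (ha : ordGT a 0) : ∃ b ∈ A0, a = q * b := by
  obtain ⟨n, hn, ha⟩ := ha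
  have hn' : 1 ≤ n := by exact_mod_cast hn
  refine ⟨q ^ (-1 : ℤ) * a, zpow_neg_mul_mem_of_le ha hn', ?_⟩
  rw [zpow_neg_one, mul_inv_cancel_left₀ q_ne_zero]

lemma one_sub_inv_ordGE {a : K} (ha : ordGT a 0) : 1 - a ≠ 0 ∧ ordGE (1 - a)⁻¹ 0 := by
  obtain ⟨b, hb, rfl⟩ := ha.exists_eq_q_mul
  have h := one_add_inv_mem (A0.neg_mem hb)
  rw [mul_neg, ← sub_eq_add_neg] at h
  exact ⟨h.1, ordGE_of_mem h.2⟩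

lemma inUnitBall.ne_zero {a : K} {l : ℤ} (h : inUnitBall a l) : a ≠ 0 := by
  obtain ⟨b, hb, rfl⟩ := h
  exact mul_ne_zero (zpow_ne_zero _ q_ne_zero) (one_add_inv_mem hb).1

lemma inUnitBall.toOrdGE {a : K} {l : ℤ} (h : inUnitBall a l) : ordGE a l := by
  obtain ⟨b, hb, rfl⟩ := h
  refine ((ordGE_zpow l).mul (ordGE_of_mem
    (A0.add_mem A0.one_mem (A0.mul_mem q_mem hb)))).of_le (by simp)

lemma inUnitBall.inv {a : K} {l : ℤ} (h : inUnitBall a l) : inUnitBall a⁻¹ (-l) := by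
  obtain ⟨b, hb, rfl⟩ := h
  have h := one_add_inv_mem hb
  refine ⟨-b * (1 + q * b)⁻¹, A0.mul_mem (A0.neg_mem hb) h.2, ?_⟩
  rw [mul_inv, ← zpow_neg]
  congr 1
  have := h.1
  field_simp
  ring

lemma inUnitBall.mul {a b : K} {l m : ℤ} (ha : inUnitBall a l) (hb : inUnitBall b m) :
    inUnitBall (a * b) (l + m) := by
  obtain ⟨x, hx, rfl⟩ := ha
  obtain ⟨y, hy, rfl⟩ := hb
  refine ⟨x + y + q * (x * y), A0.add_mem (A0.add_mem hx hy)
    (A0.mul_mem q_mem (A0.mul_mem hx hy)), ?_⟩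
  rw [zpow_add₀ q_ne_zero]
  ring

lemma inUnitBall_zpow (n : ℤ) : inUnitBall (q ^ n) n :=
  ⟨0, A0.zero_mem, by simp⟩

lemma inUnitBall.sub_one {a : K} (h : inUnitBall a 0) : ordGE (a - 1) 1 := by
  obtain ⟨b, hb, rfl⟩ := h
  refine ⟨1, by simp, ?_⟩
  have : q ^ (-1 : ℤ) * (q ^ (0 : ℤ) * (1 + q * b) - 1) = b := by
    have := q_ne_zero
    rw [zpow_neg_one, zpow_zero]
    field_simp
    ring
  rw [this]; exact hb

lemma qint_succ (n : ℕ) : qint ((n : ℤ) + 1) = q ^ (-(n : ℤ)) * ∑ i ∈ Finset.range (n + 1), (q ^ 2) ^ i := by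
  have h0 := q_ne_zero
  have h1 : q ^ 2 - 1 ≠ 0 := sub_ne_zero.2 q_sq_ne_one
  have h2 : q - q⁻¹ ≠ 0 := by
    have : q - q⁻¹ = (q ^ 2 - 1) * q⁻¹ := by field_simp
    rw [this]; exact mul_ne_zero h1 (inv_ne_zero h0)
  rw [geom_sum_eq q_sq_ne_one, qint, div_eq_iff h2, zpow_neg, zpow_neg, zpow_add_one₀ h0, zpow_natCast]
  field_simp
  ring

lemma inUnitBall_qint_succ (n : ℕ) : inUnitBall (qint ((n : ℤ) + 1)) (-(n : ℤ)) := by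
  refine ⟨∑ i ∈ Finset.range n, q * (q ^ 2) ^ i, ?_, ?_⟩
  · exact A0.sum_mem fun i _ => A0.mul_mem q_mem (pow_mem (pow_mem q_mem 2) i)
  · rw [qint_succ, Finset.sum_range_succ', Finset.mul_sum]
    congr 1
    rw [add_comm, pow_zero]
    congr 1
    exact Finset.sum_congr rfl fun i _ => by ring

lemma qfact_ne_zero (n : ℕ) : qfact n ≠ 0 :=
  Finset.prod_ne_zero_iff.2 fun k _ => (inUnitBall_qint_succ k).ne_zero

section Filtration

variable {M : Type} [AddCommGroup M] [Module K M]

/-- The elements of order at least `r` with respect to the `A_0`-submodule `L`. -/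
def filt (L : Submodule A0 M) (r : ℝ) : AddSubmonoid M where
  carrier := {u | ∃ n : ℤ, r ≤ n ∧ q ^ (-n) • u ∈ L}
  zero_mem' := ⟨⌈r⌉, Int.le_ceil r, by simp⟩
  add_mem' := by
    have key : ∀ {m n : ℤ} {u : M}, q ^ (-n) • u ∈ L → m ≤ n → q ^ (-m) • u ∈ L := by
      intro m n u hu hmn
      have h : q ^ (-m) • u = (⟨q ^ (n - m), q_zpow_mem (by omega)⟩ : A0) • q ^ (-n) • u := by
        rw [Subring.smul_def, smul_smul, ← zpow_add₀ q_ne_zero]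
        congr 2
        ring
      rw [h]
      exact L.smul_mem _ hu
    rintro u v ⟨n, hn, hu⟩ ⟨m, hm, hv⟩
    refine ⟨min n m, by simp [hn, hm], ?_⟩
    rw [smul_add]
    exact L.add_mem (key hu (min_le_left _ _)) (key hv (min_le_right _ _))

variable {L : Submodule A0 M}

lemma filt_mono {r s : ℝ} (h : s ≤ r) {u : M} (hu : u ∈ filt L r) : u ∈ filt L s :=
  let ⟨n, hn, hu⟩ := hu; ⟨n, h.trans hn, hu⟩

lemma zpow_smul_mem_of_ord {a : K} {u : M} {m n : ℤ} (ha : q ^ (-n) * a ∈ A0)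
    (hu : q ^ (-m) • u ∈ L) : q ^ (-(n + m)) • a • u ∈ L := by
  have h : q ^ (-(n + m)) • a • u = (⟨q ^ (-n) * a, ha⟩ : A0) • q ^ (-m) • u := by
    rw [Subring.smul_def, smul_smul, smul_smul, neg_add, zpow_add₀ q_ne_zero]
    congr 1
    ring
  rw [h]
  exact L.smul_mem _ hu

lemma smul_mem_filt {a : K} {r s : ℝ} {u : M} (ha : ordGE a r) (hu : u ∈ filt L s) :
    a • u ∈ filt L (r + s) := by
  obtain ⟨n, hn, ha⟩ := ha
  obtain ⟨m, hm, hu⟩ := hu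
  exact ⟨n + m, by push_cast; linarith, zpow_smul_mem_of_ord ha hu⟩

lemma smul_mem_filt_one {a : K} {r s : ℝ} {u : M} (ha : ordGT a r) (hu : u ∈ filt L s)
    (h : 0 ≤ r + s) : a • u ∈ filt L 1 := by
  obtain ⟨n, hn, ha⟩ := ha
  obtain ⟨m, hm, hu⟩ := hu
  refine ⟨n + m, ?_, zpow_smul_mem_of_ord ha hu⟩
  have h0 : (0 : ℝ) < ((n + m : ℤ) : ℝ) := by push_cast; linarith
  have h1 : 0 < n + m := by exact_mod_cast h0
  exact_mod_cast h1

lemma filt_one_of_pos {r : ℝ} (h : 0 < r) {u : M} (hu : u ∈ filt L r) : u ∈ filt L 1 := by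
  obtain ⟨n, hn, hu⟩ := hu
  refine ⟨n, ?_, hu⟩
  have h0 : (0 : ℝ) < (n : ℝ) := h.trans_le hn
  have h1 : 0 < n := by exact_mod_cast h0
  exact_mod_cast h1

lemma mem_filt_zero_of_mem {u : M} (hu : u ∈ L) : u ∈ filt L 0 := ⟨0, by simp, by simpa using hu⟩

lemma mem_of_mem_filt_zero {u : M} (hu : u ∈ filt L 0) : u ∈ L := by
  obtain ⟨n, hn, hu⟩ := hu
  have hn : 0 ≤ n := by exact_mod_cast hn
  have h : u = (⟨q ^ n, q_zpow_mem hn⟩ : A0) • q ^ (-n) • u := by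
    rw [Subring.smul_def, smul_smul, ← zpow_add₀ q_ne_zero]
    simp
  rw [h]
  exact L.smul_mem _ hu

lemma mem_filt_one_iff {u : M} : u ∈ filt L 1 ↔ q⁻¹ • u ∈ L := by
  constructor
  · intro hu
    have h := smul_mem_filt (ordGE_zpow (-1)) hu
    rw [zpow_neg_one] at h
    exact mem_of_mem_filt_zero (filt_mono (by norm_num) h)
  · intro hu
    exact ⟨1, by simp, by rwa [zpow_neg_one]⟩

lemma neg_mem_filt {r : ℝ} {u : M} (hu : u ∈ filt L r) : -u ∈ filt L r := by
  obtain ⟨n, hn, hu⟩ := hu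
  exact ⟨n, hn, by rw [smul_neg]; exact L.neg_mem hu⟩

lemma sub_mem_filt {r : ℝ} {u v : M} (hu : u ∈ filt L r) (hv : v ∈ filt L r) :
    u - v ∈ filt L r := by
  rw [sub_eq_add_neg]; exact (filt L r).add_mem hu (neg_mem_filt hv)

/-- The solution of a linear system whose matrix is, up to rescaling, strictly triangular
modulo `q`, has the expected order. -/
lemma mem_filt_of_linear_system {B Ω : Type} [PartialOrder Ω] (ξ : B → Ω) (c : B → ℝ) (x : B → M)
    (S : Finset B) (a : B → B → K) (y : B → M)
    (hy : ∀ b ∈ S, y b ∈ filt L (c b))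
    (hx : ∀ b ∈ S, x b = y b + ∑ b' ∈ S, a b b' • x b')
    (ha : ∀ b ∈ S, ∀ b' ∈ S, ordGE (a b b') (c b - c b'))
    (ha' : ∀ b ∈ S, ∀ b' ∈ S, ¬ ξ b' < ξ b → ordGT (a b b') (c b - c b')) :
    ∀ b ∈ S, x b ∈ filt L (c b) := by
  induction S using Finset.induction_on generalizing a y with
  | empty => simp
  | insert s T hs ih =>
    have hsm : s ∈ insert s T := Finset.mem_insert_self _ _
    have hTm : ∀ {b}, b ∈ T → b ∈ insert s T := fun h => Finset.mem_insert_of_mem h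
    have hss : ordGT (a s s) 0 := (ha' s hsm s hsm (lt_irrefl _)).of_le (by simp)
    obtain ⟨hu0, hu⟩ := one_sub_inv_ordGE hss
    set u : K := (1 - a s s)⁻¹ with hu_def
    have hxs : x s = u • (y s + ∑ b' ∈ T, a s b' • x b') := by
      have h := hx s hsm
      rw [Finset.sum_insert hs] at h
      have h2 : (1 - a s s) • x s = y s + ∑ b' ∈ T, a s b' • x b' := by
        rw [sub_smul, one_smul, sub_eq_iff_eq_add]
        conv_lhs => rw [h]
        abel
      rw [← h2, smul_smul, hu_def, inv_mul_cancel₀ hu0, one_smul]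
    have hT : ∀ b ∈ T, x b ∈ filt L (c b) := by
      refine ih (fun b b' => a b b' + a b s * u * a s b') (fun b => y b + (a b s * u) • y s)
        ?_ ?_ ?_ ?_
      · intro b hb
        refine (filt L _).add_mem (hy b (hTm hb)) ?_
        exact filt_mono (by linarith)
          (smul_mem_filt ((ha b (hTm hb) s hsm).mul hu) (hy s hsm))
      · intro b hb
        have h := hx b (hTm hb)
        rw [Finset.sum_insert hs, hxs] at h
        rw [h]
        simp only [add_smul, Finset.sum_add_distrib, smul_add, Finset.smul_sum, smul_smul,
          mul_assoc]
        abel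
      · intro b hb b' hb'
        refine (ha b (hTm hb) b' (hTm hb')).add ?_
        exact (((ha b (hTm hb) s hsm).mul hu).mul (ha s hsm b' (hTm hb'))).of_le (by linarith)
      · intro b hb b' hb' hlt
        refine (ha' b (hTm hb) b' (hTm hb') hlt).add ?_
        by_cases h1 : ξ s < ξ b
        · have h2 : ¬ ξ b' < ξ s := fun h => hlt (h.trans h1)
          exact (((ha b (hTm hb) s hsm).mul hu).mul_ordGT
            (ha' s hsm b' (hTm hb') h2)).of_le (by linarith)
        · exact (((ha' b (hTm hb) s hsm h1).mul_ordGE hu).mul_ordGE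
            (ha s hsm b' (hTm hb'))).of_le (by linarith)
    intro b hb
    rcases Finset.mem_insert.1 hb with rfl | hb
    · rw [hxs]
      refine filt_mono (by linarith) (smul_mem_filt hu (?_ : _ ∈ filt L (c b)))
      refine (filt L _).add_mem (hy b hsm) ((filt L _).sum_mem fun b' hb' => ?_)
      exact filt_mono (by linarith) (smul_mem_filt (ha b hsm b' (hTm hb')) (hT b' hb'))
    · exact hT b hb

end Filtration

section Boson

variable {M : Type} [AddCommGroup M] [Module K M]

/-- The divided power `f^{(n)}` of an endomorphism. -/
def divPow (f : Module.End K M) (n : ℕ) : Module.End K M := (qfact n)⁻¹ • f ^ n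

lemma divPow_zero (f : Module.End K M) (v : M) : divPow f 0 v = v := by
  simp [divPow, qfact]

lemma apply_divPow (f : Module.End K M) (n : ℕ) (v : M) :
    f (divPow f n v) = qint ((n : ℤ) + 1) • divPow f (n + 1) v := by
  have h : qint ((n : ℤ) + 1) ≠ 0 := (inUnitBall_qint_succ n).ne_zero
  simp only [divPow, LinearMap.smul_apply, map_smul, smul_smul, pow_succ', Module.End.mul_apply]
  congr 1
  rw [qfact, qfact, Finset.prod_range_succ, mul_inv, mul_comm, mul_assoc, inv_mul_cancel₀ h,
    mul_one]

variable {e f : Module.End K M} (hef : ∀ u, e (f u) = q ^ (-2 : ℤ) • f (e u) + u)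
include hef

lemma apply_pow_of_ker {v : M} (hv : e v = 0) (n : ℕ) :
    e ((f ^ (n + 1)) v) = (q ^ (-(n : ℤ)) * qint ((n : ℤ) + 1)) • (f ^ n) v := by
  have h0 := q_ne_zero
  induction n with
  | zero =>
    have h : qint 1 = 1 := by simpa using qint_succ 0
    simp [hef, hv, h]
  | succ n ih =>
    rw [pow_succ', Module.End.mul_apply, hef, ih, map_smul, ← Module.End.mul_apply,
      ← pow_succ', smul_smul]
    nth_rewrite 2 [← one_smul K ((f ^ (n + 1)) v)]
    rw [← add_smul]
    congr 1
    rw [qint_succ, qint_succ, Finset.sum_range_succ (n := n + 1)]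
    push_cast
    simp only [neg_add, zpow_add₀ h0, zpow_neg, zpow_natCast, zpow_one]
    field_simp
    ring

lemma apply_divPow_succ_of_ker {v : M} (hv : e v = 0) (n : ℕ) :
    e (divPow f (n + 1) v) = q ^ (-(n : ℤ)) • divPow f n v := by
  have h : qint ((n : ℤ) + 1) ≠ 0 := (inUnitBall_qint_succ n).ne_zero
  have h2 := qfact_ne_zero n
  simp only [divPow, LinearMap.smul_apply, map_smul, smul_smul, apply_pow_of_ker hef hv]
  congr 1
  rw [qfact, Finset.prod_range_succ, ← qfact]
  field_simp

lemma exists_decomposition (N : ℕ) (u : M) (hu : (e ^ N) u = 0) :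
    ∃ v : ℕ → M, (∀ n, e (v n) = 0) ∧ u = ∑ n ∈ Finset.range N, divPow f n (v n) := by
  induction N generalizing u with
  | zero => exact ⟨0, by simp, by simpa using hu⟩
  | succ N ih =>
    obtain ⟨v, hv, hsum⟩ := ih (e u) (by rwa [pow_succ] at hu)
    let w : M := ∑ n ∈ Finset.range N, divPow f (n + 1) (q ^ (n : ℤ) • v n)
    have hw : e w = e u := by
      rw [hsum, map_sum]
      refine Finset.sum_congr rfl fun n _ => ?_
      rw [apply_divPow_succ_of_ker hef (by rw [map_smul, hv, smul_zero]), map_smul, smul_smul,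
        ← zpow_add₀ q_ne_zero]
      simp
    refine ⟨fun n => match n with | 0 => u - w | n + 1 => q ^ (n : ℤ) • v n, ?_, ?_⟩
    · rintro (_ | n)
      · simp [hw]
      · simp [hv]
    · rw [Finset.sum_range_succ', divPow_zero]
      simp [w]

lemma decomposition_unique (N : ℕ) (v : ℕ → M) (hv : ∀ n, e (v n) = 0)
    (h : ∑ n ∈ Finset.range N, divPow f n (v n) = 0) : ∀ n < N, v n = 0 := by
  induction N generalizing v with
  | zero => simp
  | succ N ih =>
    have h1 := congrArg e h
    rw [Finset.sum_range_succ', map_add, divPow_zero, hv, add_zero, map_sum, map_zero] at h1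
    have h2 := ih (fun n => q ^ (-(n : ℤ)) • v (n + 1)) (fun n => by rw [map_smul, hv, smul_zero])
      (by
        rw [← h1]
        refine Finset.sum_congr rfl fun n _ => ?_
        rw [apply_divPow_succ_of_ker hef (hv _), map_smul])
    have h3 : ∀ n < N, v (n + 1) = 0 := fun n hn =>
      (smul_eq_zero.1 (h2 n hn)).resolve_left (zpow_ne_zero _ q_ne_zero)
    rintro (_ | n) hn
    · rw [Finset.sum_range_succ', divPow_zero, Finset.sum_eq_zero, zero_add] at h
      · exact h
      · intro n hn
        rw [h3 n (Finset.mem_range.1 hn), map_zero]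
    · exact h3 n (by omega)

/-- The components `u ↦ u_n` of the decomposition `u = Σ f^{(n)} u_n` with `e u_n = 0`. -/
lemma exists_components (hnil : ∀ u, ∃ N : ℕ, (e ^ N) u = 0) :
    ∃ cmp : ℕ → M →ₗ[K] M,
      (∀ n u, e (cmp n u) = 0) ∧
      (∀ u, ∃ N : ℕ, (∀ n, N ≤ n → cmp n u = 0) ∧
        u = ∑ n ∈ Finset.range N, divPow f n (cmp n u)) ∧
      (∀ n m v, e v = 0 → cmp n (divPow f m v) = if n = m then v else 0) := by
  let Φ : (ℕ →₀ LinearMap.ker e) →ₗ[K] M :=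
    Finsupp.lsum K fun n => (divPow f n).comp (LinearMap.ker e).subtype
  have hΦs : ∀ (N : ℕ) (w : ℕ →₀ LinearMap.ker e), w.support ⊆ Finset.range N →
      Φ w = ∑ n ∈ Finset.range N, divPow f n (w n : M) := by
    intro N w hw
    change w.sum _ = _
    rw [Finsupp.sum_of_support_subset w hw _ (by simp)]
    rfl
  have hbound : ∀ w : ℕ →₀ LinearMap.ker e, ∃ N, w.support ⊆ Finset.range N := fun w =>
    ⟨w.support.sup id + 1, fun n hn => Finset.mem_range.2
      (Nat.lt_succ_of_le (Finset.le_sup (f := id) hn))⟩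
  have hinj : Function.Injective Φ := by
    rw [injective_iff_map_eq_zero]
    intro w hw
    obtain ⟨N, hN⟩ := hbound w
    rw [hΦs N w hN] at hw
    have h := decomposition_unique hef N (fun n => (w n : M)) (fun n => (w n).2) hw
    ext n
    by_cases hn : n < N
    · exact h n hn
    · have : n ∉ w.support := fun h => hn (Finset.mem_range.1 (hN h))
      rw [Finsupp.notMem_support_iff.1 this]
      rfl
  have hsing : ∀ m v (hv : e v = 0), Φ (Finsupp.single m ⟨v, hv⟩) = divPow f m v := by
    intro m v hv
    simp [Φ]
  have hsurj : Function.Surjective Φ := by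
    intro u
    obtain ⟨N, hN⟩ := hnil u
    obtain ⟨v, hv, hsum⟩ := exists_decomposition hef N u hN
    refine ⟨∑ n ∈ Finset.range N, Finsupp.single n ⟨v n, hv n⟩, ?_⟩
    rw [map_sum, hsum]
    exact Finset.sum_congr rfl fun n _ => hsing _ _ _
  let Ψ := LinearEquiv.ofBijective Φ ⟨hinj, hsurj⟩
  refine ⟨fun n => (LinearMap.ker e).subtype.comp ((Finsupp.lapply n).comp Ψ.symm.toLinearMap),
    fun n u => (Ψ.symm u n).2, fun u => ?_, fun n m v hv => ?_⟩
  · obtain ⟨N, hN⟩ := hbound (Ψ.symm u)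
    refine ⟨N, fun n hn => ?_, ?_⟩
    · have : n ∉ (Ψ.symm u).support := fun h => absurd (Finset.mem_range.1 (hN h)) (by omega)
      simp [Finsupp.notMem_support_iff.1 this]
    · have h := hΦs N _ hN
      have h2 : Φ (Ψ.symm u) = u := Ψ.apply_symm_apply u
      rw [h2] at h
      exact h
  · have h : Ψ.symm (divPow f m v) = Finsupp.single m ⟨v, hv⟩ := by
      rw [LinearEquiv.symm_apply_eq]
      exact (hsing m v hv).symm
    simp only [LinearMap.comp_apply, LinearEquiv.coe_coe, h, Finsupp.lapply_apply,
      Finsupp.single_apply, Submodule.subtype_apply]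
    by_cases hnm : m = n
    · simp [hnm]
    · simp [hnm, Ne.symm hnm]

end Boson

section Components

variable {M : Type} [AddCommGroup M] [Module K M] {e f : Module.End K M}
  {cmp : ℕ → M →ₗ[K] M}

lemma cmp_apply_e (hef : ∀ u, e (f u) = q ^ (-2 : ℤ) • f (e u) + u)
    (hker : ∀ n u, e (cmp n u) = 0)
    (hsum : ∀ u, ∃ N : ℕ, (∀ n, N ≤ n → cmp n u = 0) ∧
      u = ∑ n ∈ Finset.range N, divPow f n (cmp n u))
    (hcmp : ∀ n m v, e v = 0 → cmp n (divPow f m v) = if n = m then v else 0)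
    (n : ℕ) (u : M) : cmp n (e u) = q ^ (-(n : ℤ)) • cmp (n + 1) u := by
  have key : ∀ m v, e v = 0 →
      cmp n (e (divPow f m v)) = q ^ (-(n : ℤ)) • cmp (n + 1) (divPow f m v) := by
    rintro (_ | m) v hv
    · rw [hcmp _ _ _ hv, divPow_zero, hv]
      simp
    · rw [apply_divPow_succ_of_ker hef hv, map_smul, hcmp _ _ _ hv, hcmp _ _ _ hv]
      by_cases h : n = m <;> simp [h]
  obtain ⟨N, -, hu⟩ := hsum u
  rw [hu]
  simp only [map_sum, Finset.smul_sum]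
  exact Finset.sum_congr rfl fun m _ => key _ _ (hker _ _)

lemma cmp_zero_apply_f (hker : ∀ n u, e (cmp n u) = 0)
    (hsum : ∀ u, ∃ N : ℕ, (∀ n, N ≤ n → cmp n u = 0) ∧
      u = ∑ n ∈ Finset.range N, divPow f n (cmp n u))
    (hcmp : ∀ n m v, e v = 0 → cmp n (divPow f m v) = if n = m then v else 0)
    (u : M) : cmp 0 (f u) = 0 := by
  obtain ⟨N, -, hu⟩ := hsum u
  rw [hu]
  simp only [map_sum]
  refine Finset.sum_eq_zero fun m _ => ?_
  rw [apply_divPow, map_smul, hcmp _ _ _ (hker _ _)]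
  simp

lemma cmp_succ_apply_f (hker : ∀ n u, e (cmp n u) = 0)
    (hsum : ∀ u, ∃ N : ℕ, (∀ n, N ≤ n → cmp n u = 0) ∧
      u = ∑ n ∈ Finset.range N, divPow f n (cmp n u))
    (hcmp : ∀ n m v, e v = 0 → cmp n (divPow f m v) = if n = m then v else 0)
    (n : ℕ) (u : M) : cmp (n + 1) (f u) = qint ((n : ℤ) + 1) • cmp n u := by
  have key : ∀ m v, e v = 0 →
      cmp (n + 1) (f (divPow f m v)) = qint ((n : ℤ) + 1) • cmp n (divPow f m v) := by
    intro m v hv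
    rw [apply_divPow, map_smul, hcmp _ _ _ hv, hcmp _ _ _ hv]
    by_cases h : n = m <;> simp [h]
  obtain ⟨N, -, hu⟩ := hsum u
  rw [hu]
  simp only [map_sum, Finset.smul_sum]
  exact Finset.sum_congr rfl fun m _ => key _ _ (hker _ _)

end Components

section Crystal

variable {B : Type} {fb : B → B} {eb : B → Option B} {ε : B → ℕ}

lemma iterate_bind_none (n : ℕ) : (fun o => Option.bind o eb)^[n] none = none := by
  induction n with
  | zero => rfl
  | succ n ih => rw [Function.iterate_succ_apply]; exact ih

lemma eps_fb (hef : ∀ b, eb (fb b) = some b)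
    (heps : ∀ b, IsGreatest
      {n : ℕ | (fun o => Option.bind o eb)^[n] (some b) ≠ none} (ε b)) (b : B) :
    ε (fb b) = ε b + 1 := by
  have h : ∀ n, (fun o => Option.bind o eb)^[n + 1] (some (fb b)) =
      (fun o => Option.bind o eb)^[n] (some b) := fun n => by
    rw [Function.iterate_succ_apply]
    simp [hef]
  refine le_antisymm ?_ ((heps (fb b)).2 ?_)
  · have h1 := (heps (fb b)).1
    generalize ε (fb b) = m at h1
    cases m with
    | zero => omega
    | succ m =>
      rw [Set.mem_ofPred_eq, h] at h1
      exact Nat.succ_le_succ ((heps b).2 h1)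
  · rw [Set.mem_ofPred_eq, h]
    exact (heps b).1

lemma exists_eb_of_eps_ne_zero
    (heps : ∀ b, IsGreatest
      {n : ℕ | (fun o => Option.bind o eb)^[n] (some b) ≠ none} (ε b)) {b : B} (hb : ε b ≠ 0) :
    ∃ b', eb b = some b' := by
  obtain ⟨m, hm⟩ := Nat.exists_eq_succ_of_ne_zero hb
  have h1 := (heps b).1
  rw [hm, Set.mem_ofPred_eq, Function.iterate_succ_apply] at h1
  refine Option.ne_none_iff_exists'.1 fun h => h1 ?_
  simp only [Option.bind_some, h]
  exact iterate_bind_none m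

lemma eps_iterate_fb (h : ∀ b, ε (fb b) = ε b + 1) (n : ℕ) (b : B) :
    ε (fb^[n] b) = ε b + n := by
  induction n with
  | zero => rfl
  | succ n ih => rw [Function.iterate_succ_apply', h, ih, add_assoc]

lemma wt_iterate_fb {P : Type} [AddCommGroup P] {α : P} {wt : B → P}
    (h : ∀ b, wt (fb b) = wt b - α) (n : ℕ) (b : B) : wt (fb^[n] b) = wt b - n • α := by
  induction n with
  | zero => simp
  | succ n ih => rw [Function.iterate_succ_apply', h, ih, succ_nsmul]; abel

end Crystal

section Order

variable {P : Type} [AddCommGroup P] {α : P} {M : Type} [AddCommGroup M] [Module K M]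
  {e f : Module.End K M} {cmp : ℕ → M →ₗ[K] M} {B : Type} {wt : B → P} {fb : B → B}
  {eb : B → Option B} {ε : B → ℕ} {C : B → M} {Bw : P → Finset B} {Eco Fco : B → B → K}
  {cc ff ee : ℤ → ℝ}

/-- The `A_0`-submodule generated by the highest components of the `C(b)` with `ε(b) = 0`
of weight `μ`. -/
def topLattice (wt : B → P) (ε : B → ℕ) (C : B → M) (cmp : ℕ → M →ₗ[K] M) (μ : P) :
    Submodule A0 M :=
  Submodule.span A0 {x | ∃ b, wt b = μ ∧ ε b = 0 ∧ cmp 0 (C b) = x}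

lemma cmp_mem_filt_of_f {Ω : Type} [PartialOrder Ω] (ξ : B → Ω)
    (hBw : ∀ μ b, b ∈ Bw μ ↔ wt b = μ)
    (hwtf : ∀ b, wt (fb b) = wt b - α) (hε : ∀ b, ε (fb b) = ε b + 1)
    (hpred : ∀ b, ε b ≠ 0 → ∃ b', fb b' = b)
    (hFexp : ∀ b, f (C b) = ∑ b' ∈ Bw (wt b - α), Fco b b' • C b')
    (h46 : ∀ m n : ℤ, n ≤ 0 → cc n ≤ cc (m + n) + ff m)
    (h49 : ∀ b b', ordGE (Fco b b') (-(ε b : ℝ) + ff ((ε b : ℤ) + 1 - (ε b' : ℤ))))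
    (h411 : ∀ b, inUnitBall (Fco b (fb b)) (-(ε b : ℤ)))
    (h413 : ∀ b b', b' ≠ fb b → ¬ξ b' < ξ (fb b) →
      ordGT (Fco b b') (-(ε b : ℝ) + ff ((ε b : ℤ) + 1 - (ε b' : ℤ))))
    (L : P → Submodule A0 M) (n : ℕ)
    (hbase : ∀ b, (ε b = 0 ∨ ε b < n) →
      cmp n (C b) ∈ filt (L (wt b + n • α)) (cc ((n : ℤ) - ε b)))
    (hf : ∀ b, n ≤ ε b + 1 →
      cmp n (f (C b)) ∈ filt (L (wt b - α + n • α)) (cc ((n : ℤ) - (ε b + 1)) - ε b)) (b₀ : B) :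
    cmp n (C b₀) ∈ filt (L (wt b₀ + n • α)) (cc ((n : ℤ) - ε b₀)) := by
  have : ∃ pr : B → B, ∀ b, ε b ≠ 0 → fb (pr b) = b := by
    refine ⟨fun b => if h : ε b ≠ 0 then (hpred b h).choose else b, fun b hb => ?_⟩
    simp only [dif_pos hb]
    exact (hpred b hb).choose_spec
  obtain ⟨pr, hpr⟩ := this
  let G : B → Prop := fun b => ε b ≠ 0 ∧ n ≤ ε b
  have hεpr : ∀ b, G b → (ε b : ℤ) = ε (pr b) + 1 := fun b hb => by
    have h := hε (pr b)
    rw [hpr b hb.1] at h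
    exact_mod_cast h
  have hFinv : ∀ b, G b → inUnitBall (Fco (pr b) b)⁻¹ (ε (pr b)) := fun b hb => by
    have h := (h411 (pr b)).inv
    rwa [hpr b hb.1, neg_neg] at h
  refine mem_filt_of_linear_system ξ (fun b => cc ((n : ℤ) - ε b)) (fun b => cmp n (C b))
    (Bw (wt b₀))
    (fun b b' => if G b ∧ b' ≠ b then -((Fco (pr b) b)⁻¹ * Fco (pr b) b') else 0)
    (fun b => if G b then (Fco (pr b) b)⁻¹ • cmp n (f (C (pr b))) else cmp n (C b))
    ?_ ?_ ?_ ?_ b₀ ((hBw _ _).2 rfl)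
  · intro b hb
    rw [← (hBw _ _).1 hb]
    by_cases hG : G b
    · simp only [if_pos hG]
      have h1 := hf (pr b) (by have := hεpr b hG; have := hG.2; omega)
      rw [← hwtf, hpr b hG.1, ← hεpr b hG] at h1
      exact filt_mono (by push_cast; linarith) (smul_mem_filt (hFinv b hG).toOrdGE h1)
    · simp only [if_neg hG]
      exact hbase b (by by_contra! h; exact hG h)
  · intro b hb
    by_cases hG : G b
    · have h1 := hFexp (pr b)
      rw [← hwtf, hpr b hG.1, (hBw _ _).1 hb] at h1
      have h0 : Fco (pr b) b ≠ 0 := by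
        have h := (h411 (pr b)).ne_zero
        rwa [hpr b hG.1] at h
      simp only [if_pos hG, h1, map_sum, map_smul, Finset.smul_sum, smul_smul,
        ← Finset.sum_add_distrib, ← add_smul]
      rw [Finset.sum_eq_single_of_mem b hb]
      · simp [inv_mul_cancel₀ h0]
      · intro b' _ hb'
        simp [hG, hb']
    · simp [hG]
  · intro b _ b' _
    by_cases h : G b ∧ b' ≠ b
    · simp only [if_pos h]
      refine (((hFinv b h.1).toOrdGE.mul (h49 (pr b) b')).neg).of_le ?_
      have h1 := h46 ((ε b : ℤ) - ε b') (n - ε b) (by have := h.1.2; omega)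
      have h2 : (ε b : ℤ) - ε b' + (n - ε b) = n - ε b' := by ring
      rw [h2] at h1
      rw [← hεpr b h.1]
      push_cast
      linarith
    · simp only [if_neg h]
      exact ordGE_zero _
  · intro b _ b' _ hlt
    by_cases h : G b ∧ b' ≠ b
    · simp only [if_pos h]
      have hs := h413 (pr b) b'
      rw [hpr b h.1.1] at hs
      refine (((hFinv b h.1).toOrdGE.mul_ordGT (hs h.2 hlt)).neg).of_le ?_
      have h1 := h46 ((ε b : ℤ) - ε b') (n - ε b) (by have := h.1.2; omega)
      have h2 : (ε b : ℤ) - ε b' + (n - ε b) = n - ε b' := by ring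
      rw [h2] at h1
      rw [← hεpr b h.1]
      push_cast
      linarith
    · simp only [if_neg h]
      exact ordGT_zero _

lemma cmp_mem_filt {Ω : Type} [PartialOrder Ω] (ξ : B → Ω)
    (hce : ∀ n u, cmp n (e u) = q ^ (-(n : ℤ)) • cmp (n + 1) u)
    (hcf0 : ∀ u, cmp 0 (f u) = 0)
    (hcf : ∀ n u, cmp (n + 1) (f u) = qint ((n : ℤ) + 1) • cmp n u)
    (hBw : ∀ μ b, b ∈ Bw μ ↔ wt b = μ)
    (hwtf : ∀ b, wt (fb b) = wt b - α) (hε : ∀ b, ε (fb b) = ε b + 1)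
    (hpred : ∀ b, ε b ≠ 0 → ∃ b', fb b' = b)
    (hEexp : ∀ b, e (C b) = ∑ b' ∈ Bw (wt b + α), Eco b b' • C b')
    (hFexp : ∀ b, f (C b) = ∑ b' ∈ Bw (wt b - α), Fco b b' • C b')
    (h44 : cc 0 = 0)
    (h45 : ∀ m n : ℤ, 0 ≤ n → cc n ≤ (n : ℝ) + cc (m + n) + ee m)
    (h46 : ∀ m n : ℤ, n ≤ 0 → cc n ≤ cc (m + n) + ff m)
    (h49 : ∀ b b', ordGE (Fco b b') (-(ε b : ℝ) + ff ((ε b : ℤ) + 1 - (ε b' : ℤ))))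
    (h410 : ∀ b b', ordGE (Eco b b') (1 - (ε b : ℝ) + ee ((ε b : ℤ) - 1 - (ε b' : ℤ))))
    (h411 : ∀ b, inUnitBall (Fco b (fb b)) (-(ε b : ℤ)))
    (h413 : ∀ b b', b' ≠ fb b → ¬ξ b' < ξ (fb b) →
      ordGT (Fco b b') (-(ε b : ℝ) + ff ((ε b : ℤ) + 1 - (ε b' : ℤ))))
    (n : ℕ) (b : B) :
    cmp n (C b) ∈ filt (topLattice wt ε C cmp (wt b + n • α)) (cc ((n : ℤ) - ε b)) := by
  induction n generalizing b with
  | zero =>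
    refine cmp_mem_filt_of_f ξ hBw hwtf hε hpred hFexp h46 h49 h411 h413 _ 0 ?_ ?_ b
    · rintro b (hb | hb)
      · simp only [hb, Nat.cast_zero, sub_zero, h44]
        exact mem_filt_zero_of_mem (Submodule.subset_span ⟨b, by simp, hb, rfl⟩)
      · omega
    · intro b _
      rw [hcf0]
      exact AddSubmonoid.zero_mem _
  | succ n ih =>
    refine cmp_mem_filt_of_f ξ hBw hwtf hε hpred hFexp h46 h49 h411 h413 _ (n + 1) ?_ ?_ b
    · intro b hb
      have hb : ε b ≤ n := by omega
      have h1 := hce n (C b)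
      have h2 : cmp (n + 1) (C b) = ∑ b' ∈ Bw (wt b + α),
          q ^ (n : ℤ) • Eco b b' • cmp n (C b') := by
        have h3 : cmp (n + 1) (C b) = q ^ (n : ℤ) • cmp n (e (C b)) := by
          rw [h1, smul_smul, ← zpow_add₀ q_ne_zero]
          simp
        rw [h3, hEexp, map_sum, Finset.smul_sum]
        simp only [map_smul]
      rw [h2]
      refine AddSubmonoid.sum_mem _ fun b' hb' => ?_
      have h3 := ih b'
      have h4 : wt b' + n • α = wt b + (n + 1) • α := by
        rw [(hBw _ _).1 hb', succ_nsmul]; abel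
      rw [h4] at h3
      refine filt_mono ?_ (smul_mem_filt (ordGE_zpow n) (smul_mem_filt (h410 b b') h3))
      have h5 := h45 ((ε b : ℤ) - 1 - ε b') (n + 1 - ε b) (by omega)
      have h6 : (ε b : ℤ) - 1 - ε b' + (n + 1 - ε b) = n - ε b' := by ring
      rw [h6] at h5
      push_cast at h5 ⊢
      linarith
    · intro b hb
      rw [hcf]
      have h4 : wt b - α + (n + 1) • α = wt b + n • α := by
        rw [succ_nsmul]; abel
      rw [h4]
      refine filt_mono ?_ (smul_mem_filt (inUnitBall_qint_succ n).toOrdGE (ih b))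
      have h6 : ((n + 1 : ℕ) : ℤ) - (ε b + 1) = n - ε b := by push_cast; ring
      have h7 : (n : ℝ) ≤ ε b := by exact_mod_cast (by omega : n ≤ ε b)
      rw [h6]
      push_cast
      linarith

lemma cmp_succ_sub_mem_filt_of_E
    (hce : ∀ n u, cmp n (e u) = q ^ (-(n : ℤ)) • cmp (n + 1) u)
    (hBw : ∀ μ b, b ∈ Bw μ ↔ wt b = μ)
    (hwtf : ∀ b, wt (fb b) = wt b - α) (hε : ∀ b, ε (fb b) = ε b + 1)
    (hef : ∀ b, eb (fb b) = some b)
    (hEexp : ∀ b, e (C b) = ∑ b' ∈ Bw (wt b + α), Eco b b' • C b')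
    (h44 : cc 0 = 0)
    (h45 : ∀ m n : ℤ, 0 ≤ n → cc n ≤ (n : ℝ) + cc (m + n) + ee m)
    (h48 : ∀ n : ℤ, 0 < n → 0 < cc n + ee n)
    (h410 : ∀ b b', ordGE (Eco b b') (1 - (ε b : ℝ) + ee ((ε b : ℤ) - 1 - (ε b' : ℤ))))
    (h412 : ∀ b b', 0 < ε b → eb b = some b' → inUnitBall (Eco b b') (1 - (ε b : ℤ)))
    (b : B)
    (h415 : ∀ b', eb (fb b) ≠ some b' → (ε (fb b) : ℤ) ≤ (ε b' : ℤ) + 1 →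
      ordGT (Eco (fb b) b') (1 - (ε (fb b) : ℝ) + ee ((ε (fb b) : ℤ) - 1 - (ε b' : ℤ))))
    (L : P → Submodule A0 M)
    (hord : ∀ (n : ℕ) b, cmp n (C b) ∈ filt (L (wt b + n • α)) (cc ((n : ℤ) - ε b))) :
    cmp (ε b + 1) (C (fb b)) - cmp (ε b) (C b) ∈ filt (L (wt b + ε b • α)) 1 := by
  have hwt : wt (fb b) + α = wt b := by rw [hwtf]; abel
  have hbm : b ∈ Bw (wt b) := (hBw _ _).2 rfl
  have h2 : cmp (ε b + 1) (C (fb b)) = ∑ b' ∈ Bw (wt b),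
      (q ^ (ε b : ℤ) * Eco (fb b) b') • cmp (ε b) (C b') := by
    have h3 : cmp (ε b + 1) (C (fb b)) = q ^ (ε b : ℤ) • cmp (ε b) (e (C (fb b))) := by
      rw [hce, smul_smul, ← zpow_add₀ q_ne_zero]
      simp
    rw [h3, hEexp, hwt, map_sum, Finset.smul_sum]
    simp only [map_smul, smul_smul]
  rw [h2, ← Finset.add_sum_erase _ _ hbm, add_sub_right_comm]
  refine AddSubmonoid.add_mem _ ?_ (AddSubmonoid.sum_mem _ fun b' hb' => ?_)
  · have h3 := (inUnitBall_zpow (ε b)).mul (h412 (fb b) b (by rw [hε]; omega) (hef b))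
    have h4 : (ε b : ℤ) + (1 - (ε (fb b) : ℤ)) = 0 := by rw [hε]; push_cast; ring
    rw [h4] at h3
    nth_rewrite 2 [← one_smul K (cmp (ε b) (C b))]
    rw [← sub_smul]
    refine filt_mono ?_ (smul_mem_filt h3.sub_one (hord (ε b) b))
    simp [h44]
  · obtain ⟨hne, hb'⟩ := Finset.mem_erase.1 hb'
    have h3 := hord (ε b) b'
    rw [(hBw _ _).1 hb'] at h3
    have hm : (ε (fb b) : ℤ) - 1 - ε b' = ε b - ε b' := by rw [hε]; push_cast; ring
    have hc : (ε (fb b) : ℝ) = ε b + 1 := by rw [hε]; push_cast; ring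
    by_cases hlt : (0 : ℤ) < ε b - ε b'
    · refine filt_one_of_pos ?_ (smul_mem_filt ((ordGE_zpow _).mul (h410 (fb b) b')) h3)
      have h4 := h48 _ hlt
      rw [hm, hc]
      push_cast
      linarith
    · have h5 := h415 b' (by rw [hef]; simpa using hne.symm) (by omega)
      refine smul_mem_filt_one ((ordGE_zpow _).mul_ordGT h5) h3 ?_
      have h4 := h45 ((ε b : ℤ) - ε b') 0 le_rfl
      rw [h44, add_zero] at h4
      rw [hm, hc]
      push_cast at h4 ⊢
      linarith

lemma cmp_succ_sub_mem_filt_of_F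
    (hcf : ∀ n u, cmp (n + 1) (f u) = qint ((n : ℤ) + 1) • cmp n u)
    (hBw : ∀ μ b, b ∈ Bw μ ↔ wt b = μ)
    (hwtf : ∀ b, wt (fb b) = wt b - α)
    (hFexp : ∀ b, f (C b) = ∑ b' ∈ Bw (wt b - α), Fco b b' • C b')
    (h44 : cc 0 = 0)
    (h46 : ∀ m n : ℤ, n ≤ 0 → cc n ≤ cc (m + n) + ff m)
    (h47 : ∀ n : ℤ, 0 < n → 0 < cc n + ff n)
    (h49 : ∀ b b', ordGE (Fco b b') (-(ε b : ℝ) + ff ((ε b : ℤ) + 1 - (ε b' : ℤ))))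
    (h411 : ∀ b, inUnitBall (Fco b (fb b)) (-(ε b : ℤ)))
    (b : B)
    (h414 : ∀ b', b' ≠ fb b → (ε b : ℤ) ≤ (ε b' : ℤ) - 1 →
      ordGT (Fco b b') (-(ε b : ℝ) + ff ((ε b : ℤ) + 1 - (ε b' : ℤ))))
    (L : P → Submodule A0 M)
    (hord : ∀ (n : ℕ) b, cmp n (C b) ∈ filt (L (wt b + n • α)) (cc ((n : ℤ) - ε b))) :
    cmp (ε b + 1) (C (fb b)) - cmp (ε b) (C b) ∈ filt (L (wt b + ε b • α)) 1 := by
  have hbm : fb b ∈ Bw (wt b - α) := (hBw _ _).2 (hwtf b)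
  have hinv : inUnitBall (Fco b (fb b))⁻¹ (ε b) := by
    have h := (h411 b).inv
    rwa [neg_neg] at h
  have h1 := hcf (ε b) (C b)
  rw [hFexp, map_sum, ← Finset.add_sum_erase _ _ hbm] at h1
  simp only [map_smul] at h1
  have h2 : cmp (ε b + 1) (C (fb b)) =
      ((Fco b (fb b))⁻¹ * qint ((ε b : ℤ) + 1)) • cmp (ε b) (C b) -
      ∑ b' ∈ (Bw (wt b - α)).erase (fb b),
        ((Fco b (fb b))⁻¹ * Fco b b') • cmp (ε b + 1) (C b') := by
    simp only [← smul_smul]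
    rw [← Finset.smul_sum, ← smul_sub, ← h1, add_sub_cancel_right, smul_smul,
      inv_mul_cancel₀ (h411 b).ne_zero, one_smul]
  rw [h2, sub_right_comm]
  refine sub_mem_filt ?_ (AddSubmonoid.sum_mem _ fun b' hb' => ?_)
  · have h3 := hinv.mul (inUnitBall_qint_succ (ε b))
    rw [add_neg_cancel] at h3
    nth_rewrite 2 [← one_smul K (cmp (ε b) (C b))]
    rw [← sub_smul]
    refine filt_mono ?_ (smul_mem_filt h3.sub_one (hord (ε b) b))
    simp [h44]
  · obtain ⟨hne, hb'⟩ := Finset.mem_erase.1 hb'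
    have h3 := hord (ε b + 1) b'
    have h4 : wt b' + (ε b + 1) • α = wt b + ε b • α := by
      rw [(hBw _ _).1 hb', succ_nsmul]; abel
    rw [h4] at h3
    have hm : ((ε b + 1 : ℕ) : ℤ) - ε b' = ε b + 1 - ε b' := by push_cast; ring
    rw [hm] at h3
    by_cases hlt : (0 : ℤ) < ε b + 1 - ε b'
    · refine filt_one_of_pos ?_ (smul_mem_filt (hinv.toOrdGE.mul (h49 b b')) h3)
      have h4 := h47 _ hlt
      push_cast
      linarith
    · have h5 := h414 b' hne (by omega)
      refine smul_mem_filt_one (hinv.toOrdGE.mul_ordGT h5) h3 ?_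
      have h4 := h46 ((ε b : ℤ) + 1 - ε b') 0 le_rfl
      rw [h44, add_zero] at h4
      push_cast
      linarith

lemma exists_top (hwtf : ∀ b, wt (fb b) = wt b - α) (hε : ∀ b, ε (fb b) = ε b + 1)
    (hpred : ∀ b, ε b ≠ 0 → ∃ b', fb b' = b) (L : P → Submodule A0 M)
    (hstep : ∀ b, cmp (ε b + 1) (C (fb b)) - cmp (ε b) (C b) ∈ filt (L (wt b + ε b • α)) 1)
    (b : B) :
    ∃ b₀, ε b₀ = 0 ∧ fb^[ε b] b₀ = b ∧
      cmp (ε b) (C b) - cmp 0 (C b₀) ∈ filt (L (wt b + ε b • α)) 1 := by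
  generalize hn : ε b = n
  induction n generalizing b with
  | zero => exact ⟨b, hn, rfl, by rw [sub_self]; exact AddSubmonoid.zero_mem _⟩
  | succ n ih =>
    obtain ⟨b', rfl⟩ := hpred b (by omega)
    have hb' : ε b' = n := by have := hε b'; omega
    obtain ⟨b₀, h0, h1, h2⟩ := ih b' hb'
    refine ⟨b₀, h0, by rw [Function.iterate_succ_apply', h1], ?_⟩
    have h3 := hstep b'
    have h4 : wt (fb b') + (n + 1) • α = wt b' + n • α := by
      rw [hwtf, succ_nsmul]; abel
    rw [h4]
    rw [hb'] at h3
    have h5 := AddSubmonoid.add_mem _ h3 h2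
    rwa [sub_add_sub_cancel] at h5

lemma divPow_smul_A0 (f : Module.End K M) (n : ℕ) (a : A0) (u : M) :
    divPow f n (a • u) = a • divPow f n u := by
  rw [Subring.smul_def, Subring.smul_def, map_smul]

/-- A vector whose components all lie in the lattices generated by highest components is an
`A_0`-combination of the `C(b)`. -/
lemma mem_span_of_cmp_mem
    (hker : ∀ n u, e (cmp n u) = 0)
    (hsum : ∀ u, ∃ N : ℕ, (∀ n, N ≤ n → cmp n u = 0) ∧
      u = ∑ n ∈ Finset.range N, divPow f n (cmp n u))
    (hcmp : ∀ n m v, e v = 0 → cmp n (divPow f m v) = if n = m then v else 0)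
    (hBw : ∀ μ b, b ∈ Bw μ ↔ wt b = μ)
    (hwtf : ∀ b, wt (fb b) = wt b - α) (hε : ∀ b, ε (fb b) = ε b + 1)
    (hinj : Function.Injective fb)
    (hpred : ∀ b, ε b ≠ 0 → ∃ b', fb b' = b)
    (hstep : ∀ b, cmp (ε b + 1) (C (fb b)) - cmp (ε b) (C b) ∈
      filt (topLattice wt ε C cmp (wt b + ε b • α)) 1)
    (hoff : ∀ b n, n ≠ ε b → cmp n (C b) ∈ filt (topLattice wt ε C cmp (wt b + n • α)) 1)
    {μ : P} {u : M} (hu : ∀ n : ℕ, cmp n u ∈ topLattice wt ε C cmp (μ + n • α)) :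
    u ∈ Submodule.span A0 (Set.range C) := by
  choose top htop₀ htop htopcmp using exists_top hwtf hε hpred _ hstep
  let x : B → M := fun b => divPow f (ε b) (cmp 0 (C (top b)))
  have hx : ∀ n b₀, ε b₀ = 0 → x (fb^[n] b₀) = divPow f n (cmp 0 (C b₀)) := by
    intro n b₀ h0
    have h1 : ε (fb^[n] b₀) = n := by rw [eps_iterate_fb hε, h0, zero_add]
    have h2 := htop (fb^[n] b₀)
    rw [h1] at h2
    simp only [x, h1, hinj.iterate n h2]
  have hspan : ∀ u : M, (∀ n : ℕ, cmp n u ∈ topLattice wt ε C cmp (μ + n • α)) →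
      u ∈ Submodule.span A0 (x '' Bw μ) := by
    intro u hu
    obtain ⟨N, -, hN⟩ := hsum u
    rw [hN]
    refine Submodule.sum_mem _ fun n _ => ?_
    have key : ∀ v ∈ topLattice wt ε C cmp (μ + n • α),
        divPow f n v ∈ Submodule.span A0 (x '' Bw μ) := by
      intro v hv
      induction hv using Submodule.span_induction with
      | mem v hv =>
        obtain ⟨b₀, hb, h0, rfl⟩ := hv
        rw [← hx n b₀ h0]
        refine Submodule.subset_span ⟨_, ?_, rfl⟩
        rw [Finset.mem_coe, hBw, wt_iterate_fb hwtf, hb]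
        abel
      | zero => simp
      | add v w _ _ hv hw => rw [map_add]; exact Submodule.add_mem _ hv hw
      | smul a v _ hv => rw [divPow_smul_A0]; exact Submodule.smul_mem _ _ hv
    exact key _ (hu n)
  have hdiff : ∀ b ∈ Bw μ, ∃ a : B → A0, C b - x b = ∑ b' ∈ Bw μ, (q * a b') • x b' := by
    intro b hb
    have h1 : q⁻¹ • (C b - x b) ∈ Submodule.span A0 (x '' Bw μ) := by
      refine hspan _ fun n => ?_
      rw [map_smul, ← mem_filt_one_iff, ← (hBw _ _).1 hb, map_sub, hcmp _ _ _ (hker _ _)]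
      by_cases hn : n = ε b
      · rw [if_pos hn, hn]
        exact htopcmp b
      · rw [if_neg hn, sub_zero]
        exact hoff b n hn
    obtain ⟨a, ha⟩ := Submodule.mem_span_image_finset_iff_exists_fun A0 |>.1 h1
    refine ⟨fun b' => if h : b' ∈ Bw μ then a ⟨b', h⟩ else 0, ?_⟩
    rw [eq_inv_smul_iff₀ q_ne_zero, Finset.smul_sum] at ha
    rw [← ha, ← Finset.sum_coe_sort (Bw μ)]
    refine Finset.sum_congr rfl fun b' _ => ?_
    beta_reduce
    rw [dif_pos b'.2, Subring.smul_def, smul_smul]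
  have hxL : ∀ b ∈ Bw μ, x b ∈ Submodule.span A0 (Set.range C) := by
    choose! a ha using hdiff
    have hord : ∀ b b', ordGT (-(q * (a b b' : K))) 0 := fun b b' => by
      have h1 := (ordGE_zpow 1).mul (ordGE_of_mem (a b b').2)
      rw [zpow_one] at h1
      exact h1.neg.ordGT_of_lt (by simp)
    have h := mem_filt_of_linear_system (L := Submodule.span A0 (Set.range C))
      (fun _ : B => (0 : ℕ)) (fun _ => 0) x (Bw μ) (fun b b' => -(q * (a b b' : K))) C
      (fun b _ => mem_filt_zero_of_mem (Submodule.subset_span ⟨b, rfl⟩))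
      (fun b hb => by
        simp only [neg_smul, Finset.sum_neg_distrib]
        rw [← ha b hb]
        abel)
      (fun b _ b' _ => by rw [sub_zero]; exact (hord b b').toOrdGE)
      (fun b _ b' _ _ => by rw [sub_zero]; exact hord b b')
    exact fun b hb => mem_of_mem_filt_zero (h b hb)
  refine (Submodule.span_le.2 ?_) (hspan u hu)
  rintro _ ⟨b, hb, rfl⟩
  exact hxL b hb

end Order

section Weights

variable {P : Type} {M : Type} [AddCommGroup M] [Module K M]
  {Mw : P → Submodule K M}

lemma exists_weight_projection (hdirect : DirectSum.IsInternal Mw) (μ : P) :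
    ∃ π : M →ₗ[K] M, (∀ x ∈ Mw μ, π x = x) ∧ ∀ ν, ν ≠ μ → ∀ x ∈ Mw ν, π x = 0 := by
  let Ψ := LinearEquiv.ofBijective (DirectSum.coeLinearMap Mw) hdirect
  have hΨ : ∀ ν (x : Mw ν), Ψ.symm (x : M) = DirectSum.lof K P (fun i => Mw i) ν x := by
    intro ν x
    rw [LinearEquiv.symm_apply_eq]
    exact (DirectSum.coeLinearMap_lof Mw ν x).symm
  refine ⟨(Mw μ).subtype.comp ((DirectSum.component K P (fun i => Mw i) μ).comp
    Ψ.symm.toLinearMap), fun x hx => ?_, fun ν hν x hx => ?_⟩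
  · have h := hΨ μ ⟨x, hx⟩
    simp only [LinearMap.comp_apply, LinearEquiv.coe_coe] at h ⊢
    rw [h, DirectSum.component.lof_self]
    rfl
  · have h := hΨ ν ⟨x, hx⟩
    simp only [LinearMap.comp_apply, LinearEquiv.coe_coe] at h ⊢
    rw [h, DirectSum.component.of, dif_neg hν, map_zero]

lemma eq_sum_of_eq_finsum (hdirect : DirectSum.IsInternal Mw) {B : Type} {wt : B → P}
    {C : B → M} {Bw : P → Finset B} (hBw : ∀ μ b, b ∈ Bw μ ↔ wt b = μ)
    (hCwt : ∀ b, C b ∈ Mw (wt b)) {a : B → K} (hfin : {b | a b ≠ 0}.Finite) {u : M} {μ : P}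
    (hu : u = ∑ᶠ b, a b • C b) (huμ : u ∈ Mw μ) : u = ∑ b ∈ Bw μ, a b • C b := by
  obtain ⟨π, h1, h2⟩ := exists_weight_projection hdirect μ
  have hsum : u = ∑ b ∈ hfin.toFinset ∪ Bw μ, a b • C b := by
    rw [hu]
    refine finsum_eq_sum_of_support_subset _ fun b hb => ?_
    have hb : a b ≠ 0 := fun h => hb (by simp [h])
    simp [hb]
  rw [← h1 u huμ]
  conv_lhs => rw [hsum]
  rw [map_sum, ← Finset.sum_subset Finset.subset_union_right]
  · refine Finset.sum_congr rfl fun b hb => ?_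
    rw [map_smul, h1]
    rw [← (hBw _ _).1 hb]
    exact hCwt b
  · intro b _ hb
    rw [map_smul, h2 (wt b) (fun h => hb ((hBw _ _).2 h)) _ (hCwt b), smul_zero]

lemma exists_pow_apply_eq_zero [AddCommGroup P] {α : P} (hdirect : DirectSum.IsInternal Mw) {e : Module.End K M}
    (hewt : ∀ μ, ∀ x ∈ Mw μ, e x ∈ Mw (μ + α))
    (hvan : ∀ μ : P, ∃ N : ℕ, ∀ n : ℕ, N ≤ n → Mw (μ + n • α) = ⊥) (u : M) :
    ∃ N : ℕ, (e ^ N) u = 0 := by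
  have hu : u ∈ ⨆ μ, Mw μ := by
    rw [hdirect.submodule_iSup_eq_top]
    exact Submodule.mem_top
  induction hu using Submodule.iSup_induction' with
  | mem μ x hx =>
    have h : ∀ n : ℕ, (e ^ n) x ∈ Mw (μ + n • α) := by
      intro n
      induction n with
      | zero => simpa using hx
      | succ n ih =>
        rw [pow_succ', Module.End.mul_apply, succ_nsmul, ← add_assoc]
        exact hewt _ _ ih
    obtain ⟨N, hN⟩ := hvan μ
    refine ⟨N, ?_⟩
    have h1 := h N
    rwa [hN N le_rfl, Submodule.mem_bot] at h1
  | zero => exact ⟨0, by simp⟩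
  | add x y _ _ hx hy =>
    obtain ⟨m, hm⟩ := hx
    obtain ⟨n, hn⟩ := hy
    refine ⟨m + n, ?_⟩
    rw [map_add]
    nth_rewrite 1 [add_comm m n]
    rw [pow_add, pow_add, Module.End.mul_apply, Module.End.mul_apply, hm, hn, map_zero, map_zero,
      add_zero]

lemma mem_span_range_iff {B : Type} {C : B → M} {v : M} :
    v ∈ Submodule.span A0 (Set.range C) ↔ ∃ (s : Finset B) (co : B → K),
      (∀ b ∈ s, co b ∈ Azero) ∧ v = ∑ b ∈ s, co b • C b := by
  constructor
  · intro hv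
    obtain ⟨c, rfl⟩ := Finsupp.mem_span_range_iff_exists_finsupp.1 hv
    exact ⟨c.support, fun b => c b, fun b _ => (c b).2, rfl⟩
  · rintro ⟨s, co, hco, rfl⟩
    exact Submodule.sum_mem _ fun b hb =>
      Submodule.smul_mem _ (⟨co b, hco b hb⟩ : A0) (Submodule.subset_span ⟨b, rfl⟩)

end Weights

lemma eg_mul_fg : eg * fg = (q ^ (-2 : ℤ)) • (fg * eg) + 1 := by
  have h := RingQuot.mkAlgHom_rel K EFRel.qboson
  simp only [map_mul, map_add, map_smul, map_one] at h
  exact h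

def fdiv (n : ℕ) : EF := (qfact n)⁻¹ • fg ^ n

/-- Theorem 4.8 of Enomoto–Kashiwara: a criterion for a system of generators
`{C(b)}_{b ∈ B}` of a `K[e,f]`-module `M` to be a crystal basis.  The hypotheses on
`Et`, `Ft` say exactly that they are the modified root operators `ẽ`, `f̃`. -/
theorem crystal_basis_criterion
    -- the weight lattice and the weight `α`
    (P : Type) [AddCommGroup P] [Module.Free ℤ P] (α : P) (hα : α ≠ 0)
    -- the `K[e,f]`-module `M` with its weight decomposition
    (M : Type) [AddCommGroup M] [Module EF M] [Module K M] [IsScalarTower K EF M]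
    (Mw : P → Submodule K M) (hdirect : DirectSum.IsInternal Mw)
    (hewt : ∀ (lam : P) (x : M), x ∈ Mw lam → eg • x ∈ Mw (lam + α))
    (hfwt : ∀ (lam : P) (x : M), x ∈ Mw lam → fg • x ∈ Mw (lam - α))
    (hMfin : ∀ lam : P, FiniteDimensional K (Mw lam))
    (hMvan : ∀ lam : P, ∃ N : ℕ, ∀ n : ℕ, N ≤ n → Mw (lam + n • α) = ⊥)
    -- the modified root operators
    (Et Ft : M → M)
    (hroot : ∀ (u : M) (N : ℕ) (v : ℕ → M),
      (∀ n, eg • v n = 0) → (∀ n, N ≤ n → v n = 0) →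
      u = ∑ n ∈ Finset.range N, fdiv n • v n →
      (Et u = ∑ n ∈ Finset.range N, (if n = 0 then 0 else fdiv (n - 1) • v n)) ∧
      (Ft u = ∑ n ∈ Finset.range N, fdiv (n + 1) • v n))
    -- the crystal `B`
    (B : Type) (wt : B → P) (fb : B → B) (eb : B → Option B) (ε : B → ℕ)
    (hwtf : ∀ b, wt (fb b) = wt b - α)
    (hwte : ∀ b b', eb b = some b' → wt b' = wt b + α)
    (hfe : ∀ b b', eb b = some b' → fb b' = b)
    (hef : ∀ b, eb (fb b) = some b)
    (hBfin : ∀ lam : P, {b : B | wt b = lam}.Finite)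
    (hBvan : ∀ lam : P, ∃ N : ℕ, ∀ n : ℕ, N ≤ n → ¬∃ b : B, wt b = lam + n • α)
    (heps : ∀ b, IsGreatest
      {n : ℕ | (fun o => Option.bind o eb)^[n] (some b) ≠ none} (ε b))
    -- the system of generators
    (C : B → M) (hCwt : ∀ b, C b ∈ Mw (wt b))
    (hCspan : Submodule.span K (Set.range C) = ⊤)
    -- auxiliary data
    (Ω : Type) [PartialOrder Ω] (ξ : B → Ω)
    (cc ff ee : ℤ → ℝ)
    (B' B'' : Set B) (hcover : B' ∪ B'' = Set.univ)
    -- the coefficient families (4.2), (4.3)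
    (Eco Fco : B → B → K)
    (hEfin : ∀ b, {b' : B | Eco b b' ≠ 0}.Finite)
    (hFfin : ∀ b, {b' : B | Fco b b' ≠ 0}.Finite)
    (hEexp : ∀ b, eg • C b = ∑ᶠ b' : B, Eco b b' • C b')
    (hFexp : ∀ b, fg • C b = ∑ᶠ b' : B, Fco b b' • C b')
    -- conditions (4.4)–(4.15)
    (h44 : cc 0 = 0 ∧ ∀ n : ℤ, n ≠ 0 → 0 < cc n)
    (h45 : ∀ m n : ℤ, 0 ≤ n → cc n ≤ (n : ℝ) + cc (m + n) + ee m)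
    (h46 : ∀ m n : ℤ, n ≤ 0 → cc n ≤ cc (m + n) + ff m)
    (h47 : ∀ n : ℤ, 0 < n → 0 < cc n + ff n)
    (h48 : ∀ n : ℤ, 0 < n → 0 < cc n + ee n)
    (h49 : ∀ b b', ordGE (Fco b b') (-(ε b : ℝ) + ff ((ε b : ℤ) + 1 - (ε b' : ℤ))))
    (h410 : ∀ b b', ordGE (Eco b b') (1 - (ε b : ℝ) + ee ((ε b : ℤ) - 1 - (ε b' : ℤ))))
    (h411 : ∀ b, inUnitBall (Fco b (fb b)) (-(ε b : ℤ)))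
    (h412 : ∀ b b', 0 < ε b → eb b = some b' → inUnitBall (Eco b b') (1 - (ε b : ℤ)))
    (h413 : ∀ b b', b' ≠ fb b → ¬ξ b' < ξ (fb b) →
      ordGT (Fco b b') (-(ε b : ℝ) + ff ((ε b : ℤ) + 1 - (ε b' : ℤ))))
    (h414 : ∀ b b', fb b ∈ B' → b' ≠ fb b → (ε b : ℤ) ≤ (ε b' : ℤ) - 1 →
      ordGT (Fco b b') (-(ε b : ℝ) + ff ((ε b : ℤ) + 1 - (ε b' : ℤ))))
    (h415 : ∀ b b', b ∈ B'' → eb b ≠ some b' → (ε b : ℤ) ≤ (ε b' : ℤ) + 1 →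
      ordGT (Eco b b') (1 - (ε b : ℝ) + ee ((ε b : ℤ) - 1 - (ε b' : ℤ)))) :
    -- conclusions: with `L = Σ_b A_0 C(b)`, we have `ẽL ⊆ L`, `f̃L ⊆ L`, and
    -- `ẽC(b) ≡ C(ẽb)`, `f̃C(b) ≡ C(f̃b)` mod `qL`
    (∀ v ∈ {v : M | ∃ (s : Finset B) (co : B → K),
        (∀ b ∈ s, co b ∈ Azero) ∧ v = ∑ b ∈ s, co b • C b},
      Et v ∈ {v : M | ∃ (s : Finset B) (co : B → K),
        (∀ b ∈ s, co b ∈ Azero) ∧ v = ∑ b ∈ s, co b • C b} ∧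
      Ft v ∈ {v : M | ∃ (s : Finset B) (co : B → K),
        (∀ b ∈ s, co b ∈ Azero) ∧ v = ∑ b ∈ s, co b • C b}) ∧
    (∀ b : B,
      Et (C b) - (eb b).elim 0 C ∈
        (fun v : M => q • v) '' {v : M | ∃ (s : Finset B) (co : B → K),
          (∀ b ∈ s, co b ∈ Azero) ∧ v = ∑ b ∈ s, co b • C b} ∧
      Ft (C b) - C (fb b) ∈
        (fun v : M => q • v) '' {v : M | ∃ (s : Finset B) (co : B → K),
          (∀ b ∈ s, co b ∈ Azero) ∧ v = ∑ b ∈ s, co b • C b}) := by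
  set e : Module.End K M := Algebra.lsmul K K M eg with he
  set f : Module.End K M := Algebra.lsmul K K M fg with hf
  have hEF : ∀ u, e (f u) = q ^ (-2 : ℤ) • f (e u) + u := fun u => by
    have h := congrArg (Algebra.lsmul K K M) eg_mul_fg
    rw [map_add, map_mul, map_smul, map_mul, map_one] at h
    exact LinearMap.congr_fun h u
  have hfdiv : ∀ (n : ℕ) (v : M), fdiv n • v = divPow f n v := fun n v => by
    have h : Algebra.lsmul K K M (fdiv n) = divPow f n := by
      rw [fdiv, map_smul, map_pow, divPow]
    exact LinearMap.congr_fun h v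
  obtain ⟨cmp, hker, hsum, hcmp⟩ := exists_components hEF
    (exists_pow_apply_eq_zero hdirect (fun μ x hx => hewt μ x hx) hMvan)
  have hext : ∀ u v : M, (∀ n, cmp n u = cmp n v) → u = v := by
    intro u v h
    obtain ⟨N, -, hN⟩ := hsum (u - v)
    rw [← sub_eq_zero, hN]
    exact Finset.sum_eq_zero fun n _ => by rw [map_sub, h, sub_self, map_zero]
  have hEt : ∀ n u, cmp n (Et u) = cmp (n + 1) u := by
    intro n u
    obtain ⟨N, hN0, hN⟩ := hsum u
    rw [(hroot u N (fun n => cmp n u) (fun n => hker n u) hN0 (by simpa only [hfdiv] using hN)).1,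
      map_sum]
    by_cases hn : n + 1 < N
    · rw [Finset.sum_eq_single_of_mem (n + 1) (Finset.mem_range.2 hn)]
      · simp [hfdiv, hcmp _ _ _ (hker _ _)]
      · rintro (_ | m) _ hm
        · simp
        · have hm : n ≠ m := by omega
          simp [hfdiv, hcmp _ _ _ (hker _ _), hm]
    · rw [hN0 _ (by omega)]
      refine Finset.sum_eq_zero fun m hm => ?_
      have hm := Finset.mem_range.1 hm
      rcases m with _ | m
      · simp
      · have hm : n ≠ m := by omega
        simp [hfdiv, hcmp _ _ _ (hker _ _), hm]
  have hFt : ∀ u, cmp 0 (Ft u) = 0 ∧ ∀ n, cmp (n + 1) (Ft u) = cmp n u := by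
    intro u
    obtain ⟨N, hN0, hN⟩ := hsum u
    rw [(hroot u N (fun n => cmp n u) (fun n => hker n u) hN0 (by simpa only [hfdiv] using hN)).2]
    simp only [hfdiv, map_sum, hcmp _ _ _ (hker _ _)]
    refine ⟨by simp, fun n => ?_⟩
    simp only [add_left_inj, Finset.sum_ite_eq, Finset.mem_range]
    split_ifs with hn
    · rfl
    · exact (hN0 n (by omega)).symm
  let Bw : P → Finset B := fun μ => (hBfin μ).toFinset
  have hBw : ∀ μ b, b ∈ Bw μ ↔ wt b = μ := fun μ b => by simp [Bw]
  have hε := eps_fb hef heps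
  have heb : ∀ b, ε b ≠ 0 → ∃ b', eb b = some b' := fun b => exists_eb_of_eps_ne_zero heps
  have hpred : ∀ b, ε b ≠ 0 → ∃ b', fb b' = b := fun b hb =>
    let ⟨b', h⟩ := heb b hb; ⟨b', hfe b b' h⟩
  have hinj : Function.Injective fb := fun b b' h => by
    have h1 := hef b
    rw [h, hef] at h1
    exact (Option.some_injective _ h1).symm
  have hE : ∀ b, e (C b) = ∑ b' ∈ Bw (wt b + α), Eco b b' • C b' := fun b =>
    eq_sum_of_eq_finsum hdirect hBw hCwt (hEfin b) (hEexp b) (hewt _ _ (hCwt b))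
  have hF : ∀ b, f (C b) = ∑ b' ∈ Bw (wt b - α), Fco b b' • C b' := fun b =>
    eq_sum_of_eq_finsum hdirect hBw hCwt (hFfin b) (hFexp b) (hfwt _ _ (hCwt b))
  have hce := cmp_apply_e hEF hker hsum hcmp
  have hcf := cmp_succ_apply_f hker hsum hcmp
  have hord := cmp_mem_filt ξ hce (cmp_zero_apply_f hker hsum hcmp) hcf hBw hwtf hε hpred hE hF
    h44.1 h45 h46 h49 h410 h411 h413
  have hoff : ∀ b n, n ≠ ε b →
      cmp n (C b) ∈ filt (topLattice wt ε C cmp (wt b + n • α)) 1 := fun b n hn =>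
    filt_one_of_pos (h44.2 _ (by omega)) (hord n b)
  have hstep : ∀ b, cmp (ε b + 1) (C (fb b)) - cmp (ε b) (C b) ∈
      filt (topLattice wt ε C cmp (wt b + ε b • α)) 1 := by
    intro b
    have hb : fb b ∈ B' ∪ B'' := hcover ▸ Set.mem_univ _
    rcases hb with hb | hb
    · exact cmp_succ_sub_mem_filt_of_F hcf hBw hwtf hF h44.1 h46 h47 h49 h411 b
        (fun b' => h414 b b' hb) _ hord
    · exact cmp_succ_sub_mem_filt_of_E hce hBw hwtf hε hef hE h44.1 h45 h48 h410 h412 b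
        (fun b' => h415 (fb b) b' hb) _ hord
  have hdiff : ∀ b n, cmp (n + 1) (C (fb b)) - cmp n (C b) ∈
      filt (topLattice wt ε C cmp (wt b + n • α)) 1 := by
    intro b n
    by_cases hn : n = ε b
    · rw [hn]; exact hstep b
    · have h := hoff (fb b) (n + 1) (by rw [hε]; omega)
      have h1 : wt (fb b) + (n + 1) • α = wt b + n • α := by
        rw [hwtf, succ_nsmul]; abel
      rw [h1] at h
      exact sub_mem_filt h (hoff b n hn)
  have hcong : ∀ (μ : P) (d : M),
      (∀ n : ℕ, cmp n d ∈ filt (topLattice wt ε C cmp (μ + n • α)) 1) →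
      q⁻¹ • d ∈ Submodule.span A0 (Set.range C) := fun μ d hd =>
    mem_span_of_cmp_mem hker hsum hcmp hBw hwtf hε hinj hpred hstep hoff (μ := μ) fun n => by
      rw [map_smul, ← mem_filt_one_iff]; exact hd n
  have hEC : ∀ b, q⁻¹ • (Et (C b) - (eb b).elim 0 C) ∈ Submodule.span A0 (Set.range C) := by
    intro b
    cases hb : eb b with
    | none =>
      have h0 : ε b = 0 := by
        by_contra h
        obtain ⟨b', h'⟩ := heb b h
        rw [hb] at h'
        cases h'
      refine hcong (wt b + α) _ fun n => ?_
      have h1 : wt b + α + n • α = wt b + (n + 1) • α := by rw [succ_nsmul]; abel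
      rw [Option.elim_none, sub_zero, hEt, h1]
      exact hoff b (n + 1) (by omega)
    | some b' =>
      obtain rfl := hfe b b' hb
      refine hcong (wt b') _ fun n => ?_
      rw [Option.elim_some, map_sub, hEt]
      exact hdiff b' n
  have hFC : ∀ b, q⁻¹ • (Ft (C b) - C (fb b)) ∈ Submodule.span A0 (Set.range C) := by
    intro b
    refine hcong (wt b - α) _ ?_
    rintro (_ | n)
    · rw [map_sub, (hFt _).1, zero_sub, ← hwtf]
      exact neg_mem_filt (hoff _ _ (by rw [hε]; omega))
    · have h1 : wt b - α + (n + 1) • α = wt b + n • α := by rw [succ_nsmul]; abel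
      rw [map_sub, (hFt _).2, h1, ← neg_sub]
      exact neg_mem_filt (hdiff b n)
  have hCmem : ∀ b, C b ∈ Submodule.span A0 (Set.range C) := fun b =>
    Submodule.subset_span ⟨b, rfl⟩
  have hq : ∀ {v : M}, q⁻¹ • v ∈ Submodule.span A0 (Set.range C) →
      v ∈ Submodule.span A0 (Set.range C) := fun h =>
    mem_of_mem_filt_zero (filt_mono zero_le_one (mem_filt_one_iff.2 h))
  have hlin : ∀ T : M → M, (∀ (s : Finset B) (co : B → K),
      T (∑ b ∈ s, co b • C b) = ∑ b ∈ s, co b • T (C b)) →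
      (∀ b, T (C b) ∈ Submodule.span A0 (Set.range C)) →
      ∀ v ∈ Submodule.span A0 (Set.range C), T v ∈ Submodule.span A0 (Set.range C) := by
    intro T hT hTC v hv
    obtain ⟨s, co, hco, rfl⟩ := mem_span_range_iff.1 hv
    rw [hT]
    exact Submodule.sum_mem _ fun b hb =>
      Submodule.smul_mem _ (⟨co b, hco b hb⟩ : A0) (hTC b)
  have hset : {v : M | ∃ (s : Finset B) (co : B → K),
      (∀ b ∈ s, co b ∈ Azero) ∧ v = ∑ b ∈ s, co b • C b} =
      (Submodule.span A0 (Set.range C) : Set M) := Set.ext fun v => mem_span_range_iff.symm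
  rw [hset]
  refine ⟨fun v hv => ⟨hlin Et ?_ ?_ v hv, hlin Ft ?_ ?_ v hv⟩, fun b => ⟨?_, ?_⟩⟩
  · intro s co
    refine hext _ _ fun n => ?_
    simp only [hEt, map_sum, map_smul]
  · intro b
    rw [← sub_add_cancel (Et (C b)) ((eb b).elim 0 C)]
    refine Submodule.add_mem _ (hq (hEC b)) ?_
    cases eb b with
    | none => exact Submodule.zero_mem _
    | some b' => exact hCmem b'
  · intro s co
    refine hext _ _ ?_
    rintro (_ | n)
    · simp only [(hFt _).1, map_sum, map_smul, smul_zero, Finset.sum_const_zero]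
    · simp only [(hFt _).2, map_sum, map_smul]
  · intro b
    rw [← sub_add_cancel (Ft (C b)) (C (fb b))]
    exact Submodule.add_mem _ (hq (hFC b)) (hCmem _)
  · exact ⟨_, hEC b, smul_inv_smul₀ q_ne_zero _⟩
  · exact ⟨_, hFC b, smul_inv_smul₀ q_ne_zero _⟩

end
end
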